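/- arXiv:1911.04358 — 3 statements merged into one kernel-verified Lean document; each statement's English description precedes it below -/
import Mathlib

section
/- Let l ≥ 27 with l ≡ r_l (mod 3), 0 ≤ r_l ≤ 2. For all n ≥ 2l³, pr(K_n, P_l) = (⌊l/3⌋ - 1)·n - C(⌊l/3⌋, 2) + 1 + r_l. -/
/-- Number of distinct colors used on the edges of `K_n` by the edge-coloring `c`. -/
def colorsUsed (n : ℕ) (c : Fin n → Fin n → ℕ) : ℕ :=
  ((Finset.univ.filter fun p : Fin n × Fin n => p.1 ≠ p.2).image fun p => c p.1 p.2).card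

/-- The edge-colored `K_n` contains a properly colored path on `l` vertices. -/
def HasPCPath (n l : ℕ) (c : Fin n → Fin n → ℕ) : Prop :=
  ∃ p : Fin l → Fin n, Function.Injective p ∧
    ∀ i : ℕ, (h : i + 2 < l) →
      c (p ⟨i, by omega⟩) (p ⟨i + 1, by omega⟩) ≠
        c (p ⟨i + 1, by omega⟩) (p ⟨i + 2, h⟩)

/-- A vertex list, read as a path, is properly colored if consecutive edges differ in color. -/
def PCList {V : Type*} (c : V → V → ℕ) : List V → Prop
  | x :: y :: z :: t => c x y ≠ c y z ∧ PCList c (y :: z :: t)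
  | _ => True

section Lists

variable {V : Type*} {c : V → V → ℕ}

@[simp] lemma pcList_nil : PCList c [] := trivial

@[simp] lemma pcList_singleton (x : V) : PCList c [x] := trivial

@[simp] lemma pcList_pair (x y : V) : PCList c [x, y] := trivial

@[simp] lemma pcList_cons₃ (x y z : V) (t : List V) :
    PCList c (x :: y :: z :: t) ↔ c x y ≠ c y z ∧ PCList c (y :: z :: t) := Iff.rfl

lemma PCList.tail {x : V} {t : List V} (h : PCList c (x :: t)) : PCList c t := by
  match t with
  | [] => trivial
  | [_] => trivial
  | _ :: _ :: _ => exact h.2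

lemma PCList.cons_of_ne {x a : V} {t : List V} (h : PCList c (a :: t))
    (hx : ∀ b s, t = b :: s → c x a ≠ c a b) : PCList c (x :: a :: t) := by
  match t with
  | [] => trivial
  | b :: s => exact ⟨hx b s rfl, h⟩

lemma PCList.append_right : ∀ {s t : List V}, PCList c (s ++ t) → PCList c t
  | [], _, h => h
  | _ :: _, _, h => PCList.append_right (PCList.tail h)

lemma PCList.append_left : ∀ {s t : List V}, PCList c (s ++ t) → PCList c s
  | [], _, _ => trivial
  | [_], _, _ => trivial
  | [_, _], _, _ => trivial
  | _ :: y :: z :: s, _, h => ⟨h.1, PCList.append_left (s := y :: z :: s) h.2⟩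

lemma PCList.append_overlap {x y : V} {t : List V} : ∀ {s : List V},
    PCList c (s ++ [x, y]) → PCList c (x :: y :: t) → PCList c (s ++ x :: y :: t)
  | [], _, h => h
  | [_], h₁, h₂ => ⟨h₁.1, h₂⟩
  | [_, _], h₁, h₂ => ⟨h₁.1, h₁.2.1, h₂⟩
  | _ :: b :: d :: s, h₁, h₂ => ⟨h₁.1, PCList.append_overlap (s := b :: d :: s) h₁.2 h₂⟩

/-- Gluing two properly colored lists that share the vertex `a`. -/
lemma PCList.append_glue {a : V} {s t : List V} (hs : PCList c (s ++ [a]))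
    (ht : PCList c (a :: t))
    (h : ∀ s' e b t', s = s' ++ [e] → t = b :: t' → c e a ≠ c a b) :
    PCList c (s ++ a :: t) := by
  rcases List.eq_nil_or_concat s with rfl | ⟨s', e, rfl⟩
  · exact ht
  · rcases t with _ | ⟨b, t'⟩
    · exact hs
    · have hs' : PCList c (s' ++ [e, a]) := by simpa using hs
      have := PCList.append_overlap hs' (t := b :: t') ⟨h s' e b t' (by simp) rfl, ht⟩
      simpa using this

lemma PCList.getElem_ne : ∀ {L : List V}, PCList c L → ∀ (i : ℕ) (h : i + 2 < L.length),
    c L[i] L[i + 1] ≠ c L[i + 1] L[i + 2]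
  | [], _, _, h => by simp at h
  | [_], _, _, h => by simp at h
  | [_, _], _, _, h => by simp at h
  | _ :: _ :: _ :: _, hL, 0, _ => hL.1
  | x :: y :: z :: t, hL, i + 1, h =>
      PCList.getElem_ne (L := y :: z :: t) hL.2 i (by simpa using h)

lemma pcList_of_getElem_ne : ∀ {L : List V}, (∀ (i : ℕ) (h : i + 2 < L.length),
    c L[i] L[i + 1] ≠ c L[i + 1] L[i + 2]) → PCList c L
  | [], _ => trivial
  | [_], _ => trivial
  | [_, _], _ => trivial
  | x :: y :: z :: t, h =>
      ⟨h 0 (by simp), pcList_of_getElem_ne fun i hi => h (i + 1) (by simpa using hi)⟩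

/-- A finite set with a total relation can be listed as a chain (a Hamiltonian path in a
tournament). -/
lemma exists_isChain_insert {R : V → V → Prop} (x : V) : ∀ (L : List V), L.IsChain R →
    (∀ y ∈ L, R x y ∨ R y x) →
    ∃ L' : List V, L'.Perm (x :: L) ∧ L'.IsChain R ∧
      ∀ h ∈ L'.head?, h = x ∨ h ∈ L.head?
  | [], _, _ => ⟨[x], by simp, by simp, by simp⟩
  | [y], _, h => by
      rcases h y (by simp) with h | h
      · exact ⟨[x, y], by simp, by simpa using h, by simp⟩
      · exact ⟨[y, x], List.Perm.swap _ _ _, by simpa using h, by simp⟩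
  | y :: z :: t, hL, h => by
      rcases h y (by simp) with hxy | hyx
      · exact ⟨x :: y :: z :: t, by simp, List.isChain_cons_cons.2 ⟨hxy, hL⟩, by simp⟩
      · have hL' := List.isChain_cons_cons.1 hL
        obtain ⟨L', hp, hc, hh⟩ := exists_isChain_insert x (z :: t) hL'.2
          (fun w hw => h w (by simp [List.mem_cons.1 hw]))
        refine ⟨y :: L', (hp.cons y).trans (List.Perm.swap _ _ _), ?_, by simp⟩
        refine List.isChain_cons.2 ⟨?_, hc⟩
        intro w hw
        rcases hh w hw with rfl | hw
        · exact hyx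
        · have : z = w := by simpa using hw
          exact this ▸ hL'.1

lemma exists_isChain_of_total [DecidableEq V] {R : V → V → Prop} (Y : Finset V)
    (h : ∀ x ∈ Y, ∀ y ∈ Y, x ≠ y → R x y ∨ R y x) :
    ∃ L : List V, L.Nodup ∧ L.toFinset = Y ∧ L.IsChain R := by
  induction Y using Finset.induction_on with
  | empty => exact ⟨[], by simp⟩
  | insert x Y hx ih =>
    obtain ⟨L, hn, hY, hc⟩ := ih fun u hu v hv =>
      h u (Finset.mem_insert_of_mem hu) v (Finset.mem_insert_of_mem hv)
    have hmem : ∀ y, y ∈ L ↔ y ∈ Y := fun y => by rw [← hY, List.mem_toFinset]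
    obtain ⟨L', hp, hc', -⟩ := exists_isChain_insert x L hc fun y hy =>
      h x (by simp) y (by simp [(hmem y).1 hy]) (fun e => hx ((hmem x).1 (e ▸ hy)))
    refine ⟨L', hp.nodup_iff.2 (List.nodup_cons.2 ⟨fun hh => hx ((hmem x).1 hh), hn⟩), ?_, hc'⟩
    rw [List.toFinset_eq_of_perm _ _ hp, List.toFinset_cons, hY]

/-- A descending chain whose members have the colors of their edges to `a` can be put in front
of a path starting at `a`. -/
lemma PCList.chain_append {a : V} {t : List V} {k : V → ℕ} (ht : PCList c (a :: t)) :
    ∀ {H : List V}, H.IsChain (fun u v => c u v = k u) → (∀ u ∈ H, c u a = k u) →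
    (H.Pairwise fun u v => k u ≠ k v) → (∀ u ∈ H, ∀ b s, t = b :: s → k u ≠ c a b) →
    PCList c (H ++ a :: t)
  | [], _, _, _, _ => ht
  | [u], _, ha, _, hb => ht.cons_of_ne fun b s e => by
      rw [ha u (by simp)]; exact hb u (by simp) b s e
  | [u, v], hc, ha, hk, _ => by
      have ih := PCList.chain_append (H := [v]) ht (by simp) (fun w hw => ha w (by simp_all))
        (by simp) (fun w hw => by simp_all)
      refine ⟨?_, ih⟩
      rw [(List.isChain_cons_cons.1 hc).1, ha v (by simp)]
      simpa using hk
  | u :: v :: w :: H, hc, ha, hk, hb => by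
      have hc' := List.isChain_cons_cons.1 hc
      have ih := PCList.chain_append (H := v :: w :: H) ht hc'.2
        (fun x hx => ha x (List.mem_cons_of_mem _ hx)) (List.pairwise_cons.1 hk).2
        (fun x hx => hb x (List.mem_cons_of_mem _ hx))
      refine ⟨?_, ih⟩
      rw [hc'.1, (List.isChain_cons_cons.1 hc'.2).1]
      exact (List.pairwise_cons.1 hk).1 v (by simp)

end Lists

section Linking

variable {V : Type*} [DecidableEq V] {c : V → V → ℕ} {l : ℕ}

lemma exists_neutral_pair (hsym : ∀ x y, c x y = c y x)
    (hno : ∀ L : List V, PCList c L → L.Nodup → L.length < l)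
    {a : V} {t : List V} {k : V → ℕ} {Y : Finset V} (hL : PCList c (a :: t))
    (hnd : (a :: t).Nodup) (hdis : ∀ y ∈ Y, y ∉ a :: t) (hk : Set.InjOn k Y)
    (ha : ∀ y ∈ Y, c y a = k y) (hb : ∀ y ∈ Y, ∀ b s, t = b :: s → k y ≠ c a b)
    (hcard : l ≤ Y.card + (a :: t).length) :
    ∃ y ∈ Y, ∃ y' ∈ Y, y ≠ y' ∧ c y y' ≠ k y ∧ c y y' ≠ k y' := by
  by_contra hcon
  push Not at hcon
  obtain ⟨H, hHn, hHY, hHc⟩ := exists_isChain_of_total (R := fun u v => c u v = k u) Y (by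
    intro x hx y hy hxy
    by_cases h : c x y = k x
    · exact Or.inl h
    · exact Or.inr (by rw [hsym]; exact hcon x hx y hy hxy h))
  have hmem : ∀ y, y ∈ H ↔ y ∈ Y := fun y => by rw [← hHY, List.mem_toFinset]
  have hpc : PCList c (H ++ a :: t) := by
    refine PCList.chain_append hL hHc (fun u hu => ha u ((hmem u).1 hu)) ?_
      (fun u hu => hb u ((hmem u).1 hu))
    refine hHn.imp_of_mem ?_
    intro u v hu hv huv e
    exact huv (hk ((hmem u).1 hu) ((hmem v).1 hv) e)
  have hlen := hno _ hpc (by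
    rw [List.nodup_append']
    exact ⟨hHn, hnd, fun x hx hx' => hdis x ((hmem x).1 hx) hx'⟩)
  have : H.length = Y.card := by rw [← hHY, List.toFinset_card_of_nodup hHn]
  rw [List.length_append] at hlen
  omega

/-- Two vertices of large rainbow degree can be linked by a short properly colored path whose
end edges belong to the rainbow stars. -/
lemma exists_link (hsym : ∀ x y, c x y = c y x)
    (hno : ∀ L : List V, PCList c L → L.Nodup → L.length < l)
    {a a' : V} {t : List V} {X Y : Finset V} (hL : PCList c (a :: t))
    (hnd : (a :: t).Nodup) (haL : a' ∉ a :: t)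
    (hYd : ∀ y ∈ Y, y ∉ a' :: a :: t) (hXd : ∀ x ∈ X, x ∉ a' :: a :: t)
    (hYi : Set.InjOn (c a) Y) (hXi : Set.InjOn (c a') X)
    (hXY : ∀ x ∈ X, ∀ y ∈ Y, c a' x ≠ c a y)
    (hb : ∀ y ∈ Y, ∀ b s, t = b :: s → c a y ≠ c a b)
    (hYc : l ≤ Y.card + (a :: t).length) (hXc : l + 1 ≤ X.card + (a :: t).length) :
    ∃ x ∈ X, ∃ I : List V, 1 ≤ I.length ∧ (∀ z ∈ I, z ∈ X ∨ z ∈ Y) ∧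
      PCList c (a' :: x :: (I ++ a :: t)) ∧ (a' :: x :: (I ++ a :: t)).Nodup := by
  obtain ⟨y, hy, y', hy', hyy, h1, h2⟩ := exists_neutral_pair hsym hno (k := c a) hL hnd
    (fun y hy h => hYd y hy (List.mem_cons_of_mem _ h)) hYi (fun y _ => hsym _ _) hb hYc
  have hyL := hYd y hy
  have hyL' := hYd y' hy'
  have hbase : PCList c (y :: a :: t) :=
    hL.cons_of_ne fun b s e => by rw [hsym]; exact hb y hy b s e
  have hbase' : PCList c (y' :: a :: t) :=
    hL.cons_of_ne fun b s e => by rw [hsym]; exact hb y' hy' b s e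
  set X' := (X.erase y).erase y' with hX'
  have hX'm : ∀ {x}, x ∈ X' → x ∈ X ∧ x ≠ y ∧ x ≠ y' := by
    intro x hx
    simp only [hX', Finset.mem_erase] at hx
    exact ⟨hx.2.2, hx.2.1, hx.1⟩
  have hX'c : X.card ≤ X'.card + 2 := by
    rw [hX']
    have := Finset.pred_card_le_card_erase (s := X) (a := y)
    have := Finset.pred_card_le_card_erase (s := X.erase y) (a := y')
    omega
  by_cases hcase : ∀ x ∈ X', c x y = c a' x
  · obtain ⟨x, hx, x', hx', hxx, g1, g2⟩ := exists_neutral_pair hsym hno (k := c a')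
      (Y := X') hbase
      (List.nodup_cons.2 ⟨fun h => hyL (List.mem_cons_of_mem _ h), hnd⟩)
      (fun x hx h => by
        rcases List.mem_cons.1 h with h | h
        · exact (hX'm hx).2.1 h
        · exact hXd x (hX'm hx).1 (List.mem_cons_of_mem _ h))
      (fun x hx x' hx' e => hXi (hX'm hx).1 (hX'm hx').1 e) hcase
      (fun x hx b s e => by
        obtain ⟨rfl, -⟩ := List.cons_eq_cons.1 e
        rw [hsym y]
        exact hXY x (hX'm hx).1 y hy)
      (by simp only [List.length_cons] at hXc ⊢; omega)
    have hxm := hX'm hx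
    have hxm' := hX'm hx'
    have hxL := hXd x hxm.1
    have hxL' := hXd x' hxm'.1
    refine ⟨x', hxm'.1, [x, y], by simp, ?_, ?_, ?_⟩
    · simp only [List.mem_cons, List.not_mem_nil, or_false]
      rintro z (rfl | rfl)
      · exact Or.inl hxm.1
      · exact Or.inr hy
    · refine ⟨?_, ?_, ?_, hbase⟩
      · rw [hsym x']; exact g2.symm
      · rw [hsym x', hcase x hx]; exact g1
      · rw [hcase x hx, hsym y]; exact hXY x hxm.1 y hy
    · simp only [List.cons_append, List.nil_append, List.nodup_cons, List.mem_cons] at *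
      grind
  · push Not at hcase
    obtain ⟨x, hx, hxy⟩ := hcase
    have hxm := hX'm hx
    have hxL := hXd x hxm.1
    by_cases hneu : c x y = c a y
    · refine ⟨x, hxm.1, [y, y'], by simp, ?_, ?_, ?_⟩
      · simp only [List.mem_cons, List.not_mem_nil, or_false]
        rintro z (rfl | rfl)
        · exact Or.inr hy
        · exact Or.inr hy'
      · refine ⟨hxy.symm, ?_, ?_, hbase'⟩
        · rw [hneu]; exact h1.symm
        · rw [hsym y' a]; exact h2
      · simp only [List.cons_append, List.nil_append, List.nodup_cons, List.mem_cons] at *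
        grind
    · refine ⟨x, hxm.1, [y], by simp, ?_, ?_, ?_⟩
      · simp only [List.mem_cons, List.not_mem_nil, or_false]
        rintro z rfl
        exact Or.inr hy
      · refine ⟨hxy.symm, ?_, hbase⟩
        rw [hsym y a]; exact hneu
      · simp only [List.cons_append, List.nil_append, List.nodup_cons, List.mem_cons] at *
        grind

end Linking

section Connecting

variable {V : Type*} {c : V → V → ℕ} {l : ℕ}

lemma card_le_card_filter_ne_add_one {f : V → ℕ} {X : Finset V} (hf : Set.InjOn f X) (κ : ℕ) :
    X.card ≤ (X.filter fun x => f x ≠ κ).card + 1 := by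
  rw [← Finset.card_filter_add_card_filter_not (s := X) (fun x => f x ≠ κ)]
  refine Nat.add_le_add_left (Finset.card_le_one.2 fun x hx y hy => ?_) _
  simp only [Finset.mem_filter, not_not] at hx hy
  exact hf hx.1 hy.1 (hx.2.trans hy.2.symm)

/-- Data for joining blocks: every vertex `a` of `A` has a large star to `N a`, all these stars
together are rainbow, and the leaves avoid the vertex set `Z` of the blocks. -/
structure RainbowStars (c : V → V → ℕ) (l : ℕ) (A : Finset V) (N : V → Finset V) (Z : Set V) :
    Prop where
  rainbow : ∀ a ∈ A, ∀ a' ∈ A, ∀ x ∈ N a, ∀ x' ∈ N a', c a x = c a' x' → a = a' ∧ x = x'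
  leaf_notMem : ∀ a ∈ A, ∀ x ∈ N a, x ∉ Z
  card_le : ∀ a ∈ A, l + 5 ≤ (N a).card

/-- A properly colored list with both ends in `A`. -/
structure IsBlock (c : V → V → ℕ) (A : Finset V) (b : List V) : Prop where
  pc : PCList c b
  head : ∃ a ∈ A, ∃ t, b = a :: t
  last : ∃ a ∈ A, ∃ s, b = s ++ [a]

variable {A : Finset V} {N : V → Finset V} {Z : Set V}

lemma RainbowStars.injOn (h : RainbowStars c l A N Z) {a : V} (ha : a ∈ A) :
    Set.InjOn (c a) (N a) :=
  fun x hx x' hx' e => (h.rainbow a ha a ha x hx x' hx' e).2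

lemma exists_last_color (c : V → V → ℕ) (a : V) (s : List V) :
    ∃ κ, ∀ s' e, s = s' ++ [e] → c e a = κ := by
  rcases List.eq_nil_or_concat s with rfl | ⟨s', e, rfl⟩
  · exact ⟨0, fun s' e h => by simp at h⟩
  · refine ⟨c e a, fun s'' e' h => ?_⟩
    have h' : s' = s'' ∧ e = e' := by simpa using h
    rw [h'.2]

lemma exists_head_color (c : V → V → ℕ) (a : V) (t : List V) :
    ∃ κ, ∀ b s, t = b :: s → c a b = κ := by
  rcases t with _ | ⟨b, s⟩
  · exact ⟨0, fun b s h => by simp at h⟩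
  · refine ⟨c a b, fun b' s' h => ?_⟩
    obtain ⟨rfl, -⟩ := List.cons_eq_cons.1 h
    rfl

variable [DecidableEq V]

lemma RainbowStars.exists_pair (h : RainbowStars c l A N Z) (hsym : ∀ x y, c x y = c y x)
    {a : V} (ha : a ∈ A) (κ : ℕ) (F : Finset V) (hF : F.card ≤ l) :
    ∃ y ∈ N a, ∃ w ∈ N a, y ≠ w ∧ y ∉ F ∧ w ∉ F ∧ c a y ≠ κ ∧ c a y ≠ c y w := by
  have h1 := card_le_card_filter_ne_add_one (h.injOn ha) κ
  have h2 := h.card_le a ha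
  have h3 := Finset.le_card_sdiff F ((N a).filter fun x => c a x ≠ κ)
  obtain ⟨y, hy, w, hw, hyw⟩ := Finset.one_lt_card.1
    (show 1 < (((N a).filter fun x => c a x ≠ κ) \ F).card by omega)
  simp only [Finset.mem_sdiff, Finset.mem_filter] at hy hw
  by_cases e : c a y = c y w
  · refine ⟨w, hw.1.1, y, hy.1.1, hyw.symm, hw.2, hy.2, hw.1.2, fun e' => hyw ?_⟩
    exact h.injOn ha hy.1.1 hw.1.1 (by rw [e, e', hsym])
  · exact ⟨y, hy.1.1, w, hw.1.1, hyw, hy.2, hw.2, hy.1.2, e⟩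

/-- Consecutive blocks can be joined through the rainbow stars, and a tail of two vertices can be
added after the last block. -/
lemma RainbowStars.exists_joined (h : RainbowStars c l A N Z) (hsym : ∀ x y, c x y = c y x)
    (hno : ∀ L : List V, PCList c L → L.Nodup → L.length < l) :
    ∀ (Bs : List (List V)) (b : List V), (∀ b' ∈ b :: Bs, IsBlock c A b') →
      (b :: Bs).flatten.Nodup → (∀ z ∈ (b :: Bs).flatten, z ∈ Z) →
      ∃ t, PCList c (b ++ t) ∧ (b ++ t).Nodup ∧
        (∀ z ∈ t, z ∈ Bs.flatten ∨ ∃ a ∈ A, z ∈ N a) ∧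
        (b :: Bs).flatten.length + 2 * (Bs.length + 1) ≤ (b ++ t).length
  | [], b, hb, hn, hZ => by
    obtain ⟨hpc, -, a, ha, s, rfl⟩ := hb b (by simp)
    obtain ⟨κ, hκ⟩ := exists_last_color c a s
    obtain ⟨y, hy, w, hw, hyw, -, -, hyκ, hc⟩ := h.exists_pair hsym ha κ ∅ (by simp)
    simp only [List.flatten_cons, List.flatten_nil, List.append_nil] at hn hZ ⊢
    refine ⟨[y, w], ?_, ?_, ?_, by simp⟩
    · have := hpc.append_glue (t := [y, w]) ⟨hc, trivial⟩ (by
        intro s' e b' t' h1 h2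
        obtain ⟨rfl, -⟩ := List.cons_eq_cons.1 h2
        rw [hκ s' e h1]
        exact hyκ.symm)
      simpa using this
    · rw [List.nodup_append']
      refine ⟨hn, by simpa using hyw, fun z hz hz' => ?_⟩
      have hzZ := hZ z hz
      simp only [List.mem_cons, List.not_mem_nil, or_false] at hz'
      rcases hz' with rfl | rfl
      · exact h.leaf_notMem a ha _ hy hzZ
      · exact h.leaf_notMem a ha _ hw hzZ
    · simp only [List.mem_cons, List.not_mem_nil, or_false]
      rintro z (rfl | rfl)
      · exact Or.inr ⟨a, ha, hy⟩
      · exact Or.inr ⟨a, ha, hw⟩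
  | b :: Bs, b', hb, hn, hZ => by
    rw [List.flatten_cons, List.nodup_append'] at hn
    obtain ⟨hnb', hnB, hdis⟩ := hn
    obtain ⟨t, hpc, hnd, hmem, hlen⟩ := RainbowStars.exists_joined h hsym hno Bs b
      (fun x hx => hb x (List.mem_cons_of_mem _ hx)) hnB
      (fun z hz => hZ z (by rw [List.flatten_cons]; exact List.mem_append_right _ hz))
    obtain ⟨a, ha, t₀, rfl⟩ := (hb b (by simp)).head
    obtain ⟨hpc', -, a', ha', s, rfl⟩ := hb b' (by simp)
    have hZb' : ∀ z ∈ s ++ [a'], z ∈ Z := fun z hz =>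
      hZ z (by rw [List.flatten_cons]; exact List.mem_append_left _ hz)
    have hdisL : ∀ z ∈ s ++ [a'], z ∉ a :: t₀ ++ t := by
      intro z hz hzL
      rcases List.mem_append.1 hzL with hz' | hz'
      · exact hdis hz (by rw [List.flatten_cons]; exact List.mem_append_left _ hz')
      · rcases hmem z hz' with h' | ⟨d, hd, hd'⟩
        · exact hdis hz (by rw [List.flatten_cons]; exact List.mem_append_right _ h')
        · exact h.leaf_notMem d hd z hd' (hZb' z hz)
    rw [List.cons_append] at hpc hnd hdisL hlen
    obtain ⟨κ, hκ⟩ := exists_head_color c a (t₀ ++ t)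
    obtain ⟨κ', hκ'⟩ := exists_last_color c a' s
    set L := a :: (t₀ ++ t) with hL
    have hLl := hno L hpc hnd
    have haL : a ∈ L := by simp [hL]
    have ha'L : a' ∉ L := hdisL a' (by simp)
    have haZ : ∀ z ∈ A, ∀ x ∈ N z, x ≠ a' := fun z hz x hx e =>
      h.leaf_notMem z hz x hx (hZb' x (by simp [e]))
    set Y := ((N a).filter fun x => c a x ≠ κ) \ L.toFinset with hY
    set X := ((N a').filter fun x => c a' x ≠ κ') \ L.toFinset with hX
    have hYm : ∀ y ∈ Y, y ∈ N a ∧ c a y ≠ κ ∧ y ∉ L := fun y hy => by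
      simpa [hY, and_assoc] using hy
    have hXm : ∀ x ∈ X, x ∈ N a' ∧ c a' x ≠ κ' ∧ x ∉ L := fun y hy => by
      simpa [hX, and_assoc] using hy
    have hLc : L.toFinset.card = L.length := List.toFinset_card_of_nodup hnd
    have hYc : l + 4 ≤ Y.card + L.length := by
      have h1 := card_le_card_filter_ne_add_one (h.injOn ha) κ
      have h2 := h.card_le a ha
      have h3 := Finset.le_card_sdiff L.toFinset ((N a).filter fun x => c a x ≠ κ)
      rw [← hY] at h3
      omega
    have hXc : l + 4 ≤ X.card + L.length := by
      have h1 := card_le_card_filter_ne_add_one (h.injOn ha') κ'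
      have h2 := h.card_le a' ha'
      have h3 := Finset.le_card_sdiff L.toFinset ((N a').filter fun x => c a' x ≠ κ')
      rw [← hX] at h3
      omega
    obtain ⟨x, hx, I, hI, hImem, hIpc, hInd⟩ := exists_link hsym hno (X := X) (Y := Y) hpc hnd
      ha'L
      (fun y hy h' => (List.mem_cons.1 h').elim (haZ a ha y (hYm y hy).1) (hYm y hy).2.2)
      (fun y hy h' => (List.mem_cons.1 h').elim (haZ a' ha' y (hXm y hy).1) (hXm y hy).2.2)
      ((h.injOn ha).mono fun y hy => (hYm y hy).1)
      ((h.injOn ha').mono fun y hy => (hXm y hy).1)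
      (fun x hx y hy e => ha'L
        ((h.rainbow a' ha' a ha x (hXm x hx).1 y (hYm y hy).1 e).1 ▸ haL))
      (fun y hy b' s' e => by rw [hκ b' s' e]; exact (hYm y hy).2.1)
      (by rw [← hL]; omega) (by rw [← hL]; omega)
    have hImem' : ∀ z ∈ x :: I, ∃ d ∈ A, z ∈ N d := by
      intro z hz
      rcases List.mem_cons.1 hz with rfl | hz
      · exact ⟨a', ha', (hXm _ hx).1⟩
      · rcases hImem z hz with hz | hz
        · exact ⟨a', ha', (hXm _ hz).1⟩
        · exact ⟨a, ha, (hYm _ hz).1⟩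
    refine ⟨x :: (I ++ L), ?_, ?_, ?_, ?_⟩
    · have := hpc'.append_glue (t := x :: (I ++ L)) hIpc (by
        intro s' e b' t' h1 h2
        obtain ⟨rfl, -⟩ := List.cons_eq_cons.1 h2
        rw [hκ' s' e h1]
        exact (hXm _ hx).2.1.symm)
      simpa using this
    · rw [List.nodup_append']
      refine ⟨hnb', (List.nodup_cons.1 hInd).2, fun z hz hz' => ?_⟩
      rw [← List.cons_append] at hz'
      rcases List.mem_append.1 hz' with hz' | hz'
      · obtain ⟨d, hd, hd'⟩ := hImem' z hz'
        exact h.leaf_notMem d hd z hd' (hZb' z hz)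
      · exact hdisL z hz hz'
    · intro z hz
      rw [← List.cons_append] at hz
      rcases List.mem_append.1 hz with hz' | hz'
      · exact Or.inr (hImem' z hz')
      · rw [hL, ← List.cons_append] at hz'
        rcases List.mem_append.1 hz' with hz' | hz'
        · exact Or.inl (by rw [List.flatten_cons]; exact List.mem_append_left _ hz')
        · rcases hmem z hz' with h' | h'
          · exact Or.inl (by rw [List.flatten_cons]; exact List.mem_append_right _ h')
          · exact Or.inr h'
    · rw [List.flatten_cons]
      simp only [List.length_append, List.length_cons, List.length_nil] at hlen hI ⊢
      rw [hL, List.length_cons, List.length_append] at *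
      omega

lemma RainbowStars.flatten_length_lt (h : RainbowStars c l A N Z)
    (hsym : ∀ x y, c x y = c y x)
    (hno : ∀ L : List V, PCList c L → L.Nodup → L.length < l) {Bs : List (List V)}
    (hBs : Bs ≠ []) (hblock : ∀ b ∈ Bs, IsBlock c A b) (hn : Bs.flatten.Nodup)
    (hZ : ∀ z ∈ Bs.flatten, z ∈ Z) :
    Bs.flatten.length + 2 * (Bs.length + 1) < l := by
  obtain ⟨b, Bs, rfl⟩ := List.exists_cons_of_ne_nil hBs
  obtain ⟨t, hpc, hnd, -, hlen⟩ := h.exists_joined hsym hno Bs b hblock hn hZ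
  obtain ⟨a, ha, t₀, rfl⟩ := (hblock b (by simp)).head
  rw [List.cons_append] at hpc hnd hlen
  obtain ⟨κ, hκ⟩ := exists_head_color c a (t₀ ++ t)
  have hLl := hno _ hpc hnd
  obtain ⟨y, hy, w, hw, hyw, hyF, hwF, hyκ, hc⟩ := h.exists_pair hsym ha κ
    (a :: (t₀ ++ t)).toFinset (by rw [List.toFinset_card_of_nodup hnd]; omega)
  rw [List.mem_toFinset] at hyF hwF
  have := hno (w :: y :: a :: (t₀ ++ t)) ⟨by rw [hsym w, hsym y a]; exact hc.symm,
    hpc.cons_of_ne fun b s e => by rw [hsym y, hκ b s e]; exact hyκ⟩ (by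
    refine List.nodup_cons.2 ⟨fun h' => ?_, List.nodup_cons.2 ⟨hyF, hnd⟩⟩
    exact (List.mem_cons.1 h').elim hyw.symm hwF)
  simp only [List.length_cons] at this hlen ⊢
  omega

end Connecting

section Sparse

variable {V : Type*} {c : V → V → ℕ}

open Classical in
/-- The edges of `E` with no end in `T`. -/
noncomputable def edgesAvoiding (E : Finset (Sym2 V)) (T : Finset V) : Finset (Sym2 V) :=
  E.filter fun e => ∀ v ∈ e, v ∉ T

lemma mk_mem_edgesAvoiding {E : Finset (Sym2 V)} {T : Finset V} {x y : V} :
    s(x, y) ∈ edgesAvoiding E T ↔ s(x, y) ∈ E ∧ x ∉ T ∧ y ∉ T := by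
  simp [edgesAvoiding]

lemma edgesAvoiding_subset (E : Finset (Sym2 V)) (A : Finset V) : edgesAvoiding E A ⊆ E := by
  classical exact Finset.filter_subset _ _

variable [DecidableEq V] {E : Finset (Sym2 V)} {T₀ : Finset V} {Δ : ℕ}

lemma card_edgesAvoiding_le_insert (hdeg : ∀ v, v ∉ T₀ → (E.filter (v ∈ ·)).card ≤ Δ)
    {r : V} (hr : r ∉ T₀) (T : Finset V) :
    (edgesAvoiding E T).card ≤ (edgesAvoiding E (insert r T)).card + Δ := by
  have hsub : edgesAvoiding E T ⊆ edgesAvoiding E (insert r T) ∪ E.filter (r ∈ ·) := by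
    intro e he
    simp only [edgesAvoiding, Finset.mem_union, Finset.mem_filter, Finset.mem_insert,
      not_or] at he ⊢
    by_cases hre : r ∈ e
    · exact Or.inr ⟨he.1, hre⟩
    · exact Or.inl ⟨he.1, fun v hv => ⟨fun e' => hre (e' ▸ hv), he.2 v hv⟩⟩
  exact (Finset.card_le_card hsub).trans ((Finset.card_union_le _ _).trans
    (Nat.add_le_add_left (hdeg r hr) _))

lemma card_edgesAvoiding_le_insert_insert
    (hdeg : ∀ v, v ∉ T₀ → (E.filter (v ∈ ·)).card ≤ Δ)
    {r r' : V} (hr : r ∉ T₀) (hr' : r' ∉ T₀) (T : Finset V) :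
    (edgesAvoiding E T).card ≤ (edgesAvoiding E (insert r (insert r' T))).card + 2 * Δ := by
  have h1 := card_edgesAvoiding_le_insert hdeg hr' T
  have h2 := card_edgesAvoiding_le_insert hdeg hr (insert r' T)
  omega

/-- Growing a properly colored path inside a rainbow graph of bounded degree: either the path
reaches `i + 2` vertices, or some vertex `d` sends a single color to all remaining edges. -/
lemma exists_path_or_dominating (hsym : ∀ x y, c x y = c y x) (hE : ∀ x, s(x, x) ∉ E)
    (hr : ∀ x y x' y', s(x, y) ∈ E → s(x', y') ∈ E → c x y = c x' y' → s(x, y) = s(x', y'))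
    (hdeg : ∀ v, v ∉ T₀ → (E.filter (v ∈ ·)).card ≤ Δ) {T : Finset V} (hT : T₀ ⊆ T)
    (hne : (edgesAvoiding E T).Nonempty) (i : ℕ) :
    (∃ v u t T', T ⊆ T' ∧ PCList c (v :: u :: t) ∧ (v :: u :: t).Nodup ∧
      i + 2 ≤ (v :: u :: t).length ∧ (∀ z ∈ v :: u :: t, z ∈ T' ∧ z ∉ T) ∧
      (∃ v', v' ∉ T ∧ v' ∈ T' ∧ s(v, v') ∈ E ∧ c v u = c v v') ∧
      (edgesAvoiding E T).card ≤ (edgesAvoiding E T').card + 2 * Δ * (i + 1)) ∨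
    (∃ d d' T', T ⊆ T' ∧ d ∉ T ∧ d' ∉ T ∧ d ∈ T' ∧ s(d, d') ∈ E ∧
      (∀ r r', s(r, r') ∈ edgesAvoiding E T' → c d r = c d d') ∧
      (edgesAvoiding E T).card ≤ (edgesAvoiding E T').card + 2 * Δ * i) := by
  induction i with
  | zero =>
    left
    obtain ⟨e, he⟩ := hne
    induction e using Sym2.ind with | _ v v' =>
    rw [mk_mem_edgesAvoiding] at he
    obtain ⟨heE, hv, hv'⟩ := he
    refine ⟨v, v', [], insert v (insert v' T), ?_, by simp, ?_, by simp, ?_,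
      ⟨v', hv', by simp, heE, rfl⟩, ?_⟩
    · exact (Finset.subset_insert _ _).trans (Finset.subset_insert _ _)
    · simp only [List.nodup_cons, List.mem_cons, List.not_mem_nil, or_false, not_false_eq_true,
        List.nodup_nil, and_true]
      exact fun h => hE v (h ▸ heE)
    · simp [hv, hv']
    · simpa using card_edgesAvoiding_le_insert_insert hdeg (fun h => hv (hT h))
        (fun h => hv' (hT h)) T
  | succ i ih =>
    rcases ih with ⟨v, u, t, T', hTT', hpc, hnd, hlen, hmem, ⟨v', hv', hv'T, hvE, hvc⟩, hcard⟩ |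
      ⟨d, d', T', hTT', hd, hd', hdT', hdE, hdom, hcard⟩
    · by_cases hdom : ∀ r r', s(r, r') ∈ edgesAvoiding E T' → c v r = c v v'
      · exact Or.inr ⟨v, v', T', hTT', (hmem v (by simp)).2, hv', (hmem v (by simp)).1, hvE,
          hdom, hcard⟩
      · push Not at hdom
        obtain ⟨r, r', hrr, hc⟩ := hdom
        rw [mk_mem_edgesAvoiding] at hrr
        obtain ⟨hrE, hrT', hr'T'⟩ := hrr
        have hrT : r ∉ T := fun h => hrT' (hTT' h)
        have hr'T : r' ∉ T := fun h => hr'T' (hTT' h)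
        have hrr' : r ≠ r' := fun h => hE r (by rw [← h] at hrE; exact hrE)
        have hrL : r ∉ v :: u :: t := fun h => hrT' (hmem r h).1
        have hr'L : r' ∉ v :: u :: t := fun h => hr'T' (hmem r' h).1
        have hne' : c r r' ≠ c v v' := fun h => by
          have := hr _ _ _ _ hrE hvE h
          rcases Sym2.eq_iff.1 this with ⟨h, -⟩ | ⟨-, h⟩
          · exact hrT' (h ▸ (hmem v (by simp)).1)
          · exact hr'T' (h ▸ (hmem v (by simp)).1)
        have hcard' := card_edgesAvoiding_le_insert_insert hdeg (fun h => hrT (hT h))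
          (fun h => hr'T (hT h)) T'
        have hsub : T' ⊆ insert r (insert r' T') :=
          (Finset.subset_insert _ _).trans (Finset.subset_insert _ _)
        have hcard'' : (edgesAvoiding E T).card ≤
            (edgesAvoiding E (insert r (insert r' T'))).card + 2 * Δ * (i + 1 + 1) := by
          rw [mul_add _ (i + 1) 1]
          omega
        have hmem' : ∀ z ∈ v :: u :: t, z ∈ insert r (insert r' T') ∧ z ∉ T := fun z hz =>
          ⟨hsub (hmem z hz).1, (hmem z hz).2⟩
        left
        by_cases hvr : c r v = c r r'
        · refine ⟨r, v, u :: t, insert r (insert r' T'), hTT'.trans hsub, ⟨?_, hpc⟩,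
            List.nodup_cons.2 ⟨hrL, hnd⟩, by simp only [List.length_cons] at hlen ⊢; omega, ?_,
            ⟨r', hr'T, by simp, hrE, hvr⟩, hcard''⟩
          · rw [hvr, hvc]; exact hne'
          · intro z hz
            rcases List.mem_cons.1 hz with rfl | hz
            · exact ⟨by simp, hrT⟩
            · exact hmem' z hz
        · refine ⟨r', r, v :: u :: t, insert r (insert r' T'), hTT'.trans hsub,
            ⟨?_, ?_, hpc⟩, List.nodup_cons.2 ⟨?_, List.nodup_cons.2 ⟨hrL, hnd⟩⟩,
            by simp only [List.length_cons] at hlen ⊢; omega, ?_,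
            ⟨r, hrT, by simp, by rwa [Sym2.eq_swap], rfl⟩, hcard''⟩
          · rw [hsym r' r]; exact fun h => hvr h.symm
          · rw [hsym r v, hvc]; exact hc
          · exact fun h => (List.mem_cons.1 h).elim hrr'.symm hr'L
          · intro z hz
            rcases List.mem_cons.1 hz with rfl | hz
            · exact ⟨by simp, hr'T⟩
            · rcases List.mem_cons.1 hz with rfl | hz
              · exact ⟨by simp, hrT⟩
              · exact hmem' z hz
    · refine Or.inr ⟨d, d', T', hTT', hd, hd', hdT', hdE, hdom, hcard.trans ?_⟩
      gcongr
      omega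

/-- A rainbow graph of bounded degree with many edges forces a long properly colored path. -/
lemma exists_path_of_card_edgesAvoiding (hsym : ∀ x y, c x y = c y x) (hE : ∀ x, s(x, x) ∉ E)
    (hr : ∀ x y x' y', s(x, y) ∈ E → s(x', y') ∈ E → c x y = c x' y' → s(x, y) = s(x', y'))
    (hdeg : ∀ v, v ∉ T₀ → (E.filter (v ∈ ·)).card ≤ Δ) (j : ℕ) (T : Finset V) (hT : T₀ ⊆ T)
    (hcard : Δ * ((j + 2) * (j + 1)) < (edgesAvoiding E T).card) :
    ∃ v u t, PCList c (v :: u :: t) ∧ (v :: u :: t).Nodup ∧ j + 2 ≤ (v :: u :: t).length ∧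
      (∀ z ∈ v :: u :: t, z ∉ T) ∧ ∃ v', v' ∉ T ∧ s(v, v') ∈ E ∧ c v u = c v v' := by
  induction j generalizing T with
  | zero =>
    obtain ⟨e, he⟩ : (edgesAvoiding E T).Nonempty := Finset.card_pos.1 (by omega)
    induction e using Sym2.ind with | _ v v' =>
    rw [mk_mem_edgesAvoiding] at he
    refine ⟨v, v', [], by simp, ?_, by simp, by simp [he.2], v', he.2.2, he.1, rfl⟩
    simpa using fun h : v = v' => hE v (h ▸ he.1)
  | succ j ih =>
    have hne : (edgesAvoiding E T).Nonempty := Finset.card_pos.1 (by omega)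
    rcases exists_path_or_dominating hsym hE hr hdeg hT hne (j + 1) with
      ⟨v, u, t, T', -, hpc, hnd, hlen, hmem, ⟨v', hv', -, hvE, hvc⟩, -⟩ |
      ⟨d, d', T', hTT', hd, hd', hdT', hdE, hdom, hcard'⟩
    · exact ⟨v, u, t, hpc, hnd, hlen, fun z hz => (hmem z hz).2, v', hv', hvE, hvc⟩
    · obtain ⟨v, u, t, hpc, hnd, hlen, hmem, v', hv', hvE, hvc⟩ :=
        ih T' (hT.trans hTT') (by nlinarith)
      have hv : v ∉ T' := hmem v (by simp)
      have hdL : d ∉ v :: u :: t := fun h => hmem d h hdT'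
      have hdv : c d v = c d d' := hdom v v' (mk_mem_edgesAvoiding.2 ⟨hvE, hv, hv'⟩)
      refine ⟨d, v, u :: t, ⟨fun h => ?_, hpc⟩, List.nodup_cons.2 ⟨hdL, hnd⟩,
        by simp only [List.length_cons] at hlen ⊢; omega, fun z hz => ?_, d', hd', hdE, hdv⟩
      · have := hr d d' v v' hdE hvE (by rw [← hdv, h, hvc])
        rcases Sym2.eq_iff.1 this with ⟨h, -⟩ | ⟨h, -⟩
        · exact hv (h ▸ hdT')
        · exact hv' (h ▸ hdT')
      · rcases List.mem_cons.1 hz with rfl | hz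
        · exact hd
        · exact fun h => hmem z hz (hTT' h)

end Sparse

section Segments

variable {V : Type*} {c : V → V → ℕ} {l : ℕ}

/-- A set `A` of `l / 3 - 1` vertices joined to the large set `W` by pairwise distinct colors. -/
structure FullStars (c : V → V → ℕ) (l : ℕ) (A W : Finset V) : Prop where
  card_add_one : A.card + 1 = l / 3
  eq_of_color_eq : ∀ a ∈ A, ∀ a' ∈ A, ∀ x ∈ W, ∀ x' ∈ W, c a x = c a' x' → a = a' ∧ x = x'
  notMem : ∀ x ∈ W, x ∉ A
  card_le : l + 20 ≤ W.card

/-- At most one vertex of `A` is joined to `u` by the color `γ`. -/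
def Attachable (c : V → V → ℕ) (A : Finset V) (u : V) (γ : ℕ) : Prop :=
  (A.filter fun a => c a u = γ).card ≤ 1

/-- A properly colored path that can be extended into `A` at both ends. -/
structure IsSegment (c : V → V → ℕ) (A : Finset V) (Q : List V) : Prop where
  pc : PCList c Q
  head : ∃ u v t, Q = u :: v :: t ∧ Attachable c A u (c u v)
  last : ∃ s x y, Q = s ++ [x, y] ∧ Attachable c A y (c x y)

variable {A W : Finset V}

lemma Attachable.exists_mem {u : V} {γ : ℕ} (h : Attachable c A u γ) {R : Finset V}
    (hR : R ⊆ A) (hcard : 2 ≤ R.card) : ∃ a ∈ R, c a u ≠ γ := by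
  by_contra hcon
  push Not at hcon
  have : R ⊆ A.filter fun a => c a u = γ := fun a ha => Finset.mem_filter.2 ⟨hR ha, hcon a ha⟩
  have := Finset.card_le_card this
  have : (A.filter fun a => c a u = γ).card ≤ 1 := h
  omega

variable [DecidableEq V]

lemma IsSegment.exists_block (hsym : ∀ x y, c x y = c y x) {Q : List V} (hQ : IsSegment c A Q)
    {R : Finset V} (hR : R ⊆ A) (hcard : 3 ≤ R.card) :
    ∃ a ∈ R, ∃ a' ∈ R, a ≠ a' ∧ IsBlock c A (a :: (Q ++ [a'])) := by
  obtain ⟨u, v, t, hu, hu'⟩ := hQ.head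
  obtain ⟨s, x, y, hy, hy'⟩ := hQ.last
  obtain ⟨a, ha, hau⟩ := hu'.exists_mem hR (by omega)
  obtain ⟨a', ha', hay⟩ := hy'.exists_mem ((Finset.erase_subset a R).trans hR)
    (by rw [Finset.card_erase_of_mem ha]; omega)
  rw [Finset.mem_erase] at ha'
  refine ⟨a, ha, a', ha'.2, ha'.1.symm, ?_, ⟨a, hR ha, _, rfl⟩,
    ⟨a', hR ha'.2, a :: Q, rfl⟩⟩
  have h1 : PCList c (Q ++ [a']) := by
    have h2 := hQ.pc
    rw [hy] at h2 ⊢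
    rw [List.append_assoc]
    exact h2.append_overlap (t := [a']) ⟨by rw [hsym y]; exact hay.symm, trivial⟩
  rw [hu] at h1 ⊢
  exact ⟨hau, h1⟩

lemma exists_blocks (hsym : ∀ x y, c x y = c y x) : ∀ (Qs : List (List V)) (R : Finset V),
    R ⊆ A → (∀ Q ∈ Qs, IsSegment c A Q) → Qs.flatten.Nodup → (∀ z ∈ Qs.flatten, z ∉ A) →
    2 * Qs.length + 1 ≤ R.card → ∃ (Bs : List (List V)) (R' : Finset V), R' ⊆ R ∧
      Bs.length = Qs.length ∧ R'.card + 2 * Qs.length = R.card ∧ (∀ b ∈ Bs, IsBlock c A b) ∧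
      Bs.flatten.Nodup ∧ (∀ z ∈ Bs.flatten, z ∈ Qs.flatten ∨ z ∈ R \ R') ∧
      Bs.flatten.length = Qs.flatten.length + 2 * Qs.length
  | [], R, _, _, _, _, _ => ⟨[], R, by simp⟩
  | Q :: Qs, R, hR, hseg, hn, hA, hcard => by
    rw [List.length_cons] at hcard
    obtain ⟨a, ha, a', ha', haa', hb⟩ := (hseg Q (by simp)).exists_block hsym hR (by omega)
    rw [List.flatten_cons, List.nodup_append'] at hn
    have ha'' : a' ∈ R.erase a := Finset.mem_erase.2 ⟨haa'.symm, ha'⟩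
    have hcR : ((R.erase a).erase a').card + 2 = R.card := by
      rw [Finset.card_erase_of_mem ha'', Finset.card_erase_of_mem ha]; omega
    have hsub : (R.erase a).erase a' ⊆ R :=
      (Finset.erase_subset _ _).trans (Finset.erase_subset _ _)
    have hAQ : ∀ z ∈ Q, z ∉ A := fun z hz => hA z (by simp [hz])
    have hAQs : ∀ z ∈ Qs.flatten, z ∉ A := fun z hz =>
      hA z (by rw [List.flatten_cons]; exact List.mem_append_right _ hz)
    obtain ⟨Bs, R', hR', hlen, hcR', hBs, hBn, hBm, hBl⟩ := exists_blocks hsym Qs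
      ((R.erase a).erase a') (hsub.trans hR) (fun Q' hQ' => hseg Q' (List.mem_cons_of_mem _ hQ'))
      hn.2.1 hAQs (by omega)
    have hBm' : ∀ z ∈ Bs.flatten, z ≠ a ∧ z ≠ a' ∧ z ∉ Q := by
      intro z hz
      rcases hBm z hz with h | h
      · exact ⟨fun e => hAQs z h (e ▸ hR ha), fun e => hAQs z h (e ▸ hR ha'),
          fun h' => hn.2.2 h' h⟩
      · simp only [Finset.mem_sdiff, Finset.mem_erase] at h
        exact ⟨h.1.2.1, h.1.1, fun h' => hAQ z h' (hR h.1.2.2)⟩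
    refine ⟨(a :: (Q ++ [a'])) :: Bs, R', hR'.trans hsub, by simp [hlen],
      by rw [List.length_cons]; omega, ?_, ?_, ?_, ?_⟩
    · intro b hb'
      rcases List.mem_cons.1 hb' with rfl | hb'
      · exact hb
      · exact hBs b hb'
    · rw [List.flatten_cons, List.nodup_append']
      refine ⟨?_, hBn, ?_⟩
      · rw [List.nodup_cons, List.nodup_append', List.mem_append]
        refine ⟨?_, hn.1, by simp, ?_⟩
        · rintro (h | h)
          · exact hAQ a h (hR ha)
          · exact haa' (by simpa using h)
        · intro z hz hz'
          exact hAQ z hz ((by simpa using hz' : z = a') ▸ hR ha')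
      · intro z hz hz'
        have := hBm' z hz'
        simp [this] at hz
    · intro z hz
      rw [List.flatten_cons, List.mem_append] at hz
      have haR' : a ∉ R' := fun h => by simpa using hR' h
      have haR'' : a' ∉ R' := fun h => by simpa using hR' h
      rcases hz with hz | hz
      · rw [List.mem_cons, List.mem_append, List.mem_singleton] at hz
        rcases hz with rfl | hz | rfl
        · exact Or.inr (Finset.mem_sdiff.2 ⟨ha, haR'⟩)
        · exact Or.inl (by simp [hz])
        · exact Or.inr (Finset.mem_sdiff.2 ⟨ha', haR''⟩)
      · rcases hBm z hz with h | h
        · exact Or.inl (by rw [List.flatten_cons]; exact List.mem_append_right _ h)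
        · rw [Finset.mem_sdiff] at h
          exact Or.inr (Finset.mem_sdiff.2 ⟨hsub h.1, h.2⟩)
    · simp only [List.flatten_cons, List.length_append, List.length_cons, List.length_nil, hBl]
      omega

/-- Disjoint segments with enough vertices yield a properly colored path on `l` vertices. -/
lemma FullStars.flatten_length_lt (h : FullStars c l A W) (hl : 27 ≤ l)
    (hsym : ∀ x y, c x y = c y x)
    (hno : ∀ L : List V, PCList c L → L.Nodup → L.length < l) {Qs : List (List V)}
    (hq : Qs.length ≤ 3) (hseg : ∀ Q ∈ Qs, IsSegment c A Q) (hn : Qs.flatten.Nodup)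
    (hA : ∀ z ∈ Qs.flatten, z ∉ A) (hlen : Qs.flatten.length ≤ 15) :
    Qs.flatten.length < 2 * Qs.length + l % 3 + 1 := by
  have hAc := h.card_add_one
  obtain ⟨Bs, R, hR, hBl, hRc, hBs, hBn, hBm, hBf⟩ := exists_blocks hsym Qs A subset_rfl hseg hn
    hA (by omega)
  have hfl : (Bs ++ R.toList.map fun a => [a]).flatten = Bs.flatten ++ R.toList := by
    rw [List.flatten_append]
    congr 1
    generalize R.toList = L
    induction L with
    | nil => rfl
    | cons a L ih => simp [ih]
  have hRS : RainbowStars c l A (fun _ => W \ Qs.flatten.toFinset) {z | z ∈ Qs.flatten ∨ z ∈ A} :=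
    { rainbow := fun a ha a' ha' x hx x' hx' e => h.eq_of_color_eq a ha a' ha' x
        (Finset.mem_sdiff.1 hx).1 x' (Finset.mem_sdiff.1 hx').1 e
      leaf_notMem := fun a _ x hx hx' => by
        rw [Finset.mem_sdiff, List.mem_toFinset] at hx
        exact hx'.elim hx.2 (h.notMem x hx.1)
      card_le := fun a _ => by
        have h1 := Finset.le_card_sdiff Qs.flatten.toFinset W
        have h2 := List.toFinset_card_le Qs.flatten
        have h3 := h.card_le
        omega }
  have hlen' : (Bs ++ R.toList.map fun a => [a]).length = Qs.length + R.card := by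
    simp [hBl]
  have := hRS.flatten_length_lt hsym hno (Bs := Bs ++ R.toList.map fun a => [a])
    (fun e => by rw [e, List.length_nil] at hlen'; omega) ?_ ?_ ?_
  · rw [hfl, List.length_append, Finset.length_toList, hlen'] at this
    omega
  · intro b hb
    rcases List.mem_append.1 hb with hb | hb
    · exact hBs b hb
    · obtain ⟨a, ha, rfl⟩ := List.mem_map.1 hb
      have := hR (Finset.mem_toList.1 ha)
      exact ⟨trivial, ⟨a, this, [], rfl⟩, ⟨a, this, [], rfl⟩⟩
  · rw [hfl, List.nodup_append']
    refine ⟨hBn, R.nodup_toList, fun z hz hz' => ?_⟩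
    rw [Finset.mem_toList] at hz'
    rcases hBm z hz with h' | h'
    · exact hA z h' (hR hz')
    · exact (Finset.mem_sdiff.1 h').2 hz'
  · intro z hz
    rw [hfl, List.mem_append, Finset.mem_toList] at hz
    rcases hz with hz | hz
    · exact (hBm z hz).imp_right fun h' => (Finset.mem_sdiff.1 h').1
    · exact Or.inr (hR hz)

end Segments

section NewColors

variable {V : Type*} {c : V → V → ℕ} {l : ℕ} {A W : Finset V}

/-- The color `α` does not occur between `A` and its complement. -/
def IsNewColor (c : V → V → ℕ) (A : Finset V) (α : ℕ) : Prop :=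
  ∀ a ∈ A, ∀ u ∉ A, c a u ≠ α

lemma IsNewColor.attachable {α : ℕ} (h : IsNewColor c A α) {u : V} (hu : u ∉ A) :
    Attachable c A u α := by
  rw [Attachable, Finset.filter_false_of_mem fun a ha => h a ha u hu]
  simp

lemma FullStars.attachable (h : FullStars c l A W) {x : V} (hx : x ∈ W) (γ : ℕ) :
    Attachable c A x γ := by
  refine Finset.card_le_one.2 fun a ha a' ha' => ?_
  rw [Finset.mem_filter] at ha ha'
  exact (h.eq_of_color_eq a ha.1 a' ha'.1 x hx x hx (ha.2.trans ha'.2.symm)).1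

lemma FullStars.mono (h : FullStars c l A W) {W' : Finset V} (hW : W' ⊆ W)
    (hc : l + 20 ≤ W'.card) : FullStars c l A W' :=
  ⟨h.card_add_one, fun a ha a' ha' x hx x' hx' =>
    h.eq_of_color_eq a ha a' ha' x (hW hx) x' (hW hx'), fun x hx => h.notMem x (hW hx), hc⟩

variable [DecidableEq V]

lemma FullStars.exists_notMem (h : FullStars c l A W) (F : List V) (hF : F.length < 20) :
    ∃ w ∈ W, w ∉ F := by
  have h1 := Finset.le_card_sdiff F.toFinset W
  have h2 := List.toFinset_card_le F
  have h3 := h.card_le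
  obtain ⟨w, hw⟩ := Finset.card_pos.1 (show 0 < (W \ F.toFinset).card by omega)
  rw [Finset.mem_sdiff, List.mem_toFinset] at hw
  exact ⟨w, hw⟩

/-- Either `X` contains a properly colored path on three vertices, or it is monochromatic. -/
lemma exists_triple_or_mono (hsym : ∀ x y, c x y = c y x) (X : Finset V) :
    (∃ x ∈ X, ∃ y ∈ X, ∃ z ∈ X, [x, y, z].Nodup ∧ c x y ≠ c y z) ∨
      ∃ κ, ∀ x ∈ X, ∀ y ∈ X, x ≠ y → c x y = κ := by
  by_cases hX : ∃ p ∈ X, ∃ q ∈ X, p ≠ q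
  · obtain ⟨p, hp, q, hq, hpq⟩ := hX
    by_contra hcon
    push Not at hcon
    have h3 : ∀ x ∈ X, ∀ y ∈ X, ∀ z ∈ X, x ≠ y → y ≠ z → x ≠ z → c x y = c y z :=
      fun x hx y hy z hz h1 h2 h4 => hcon.1 x hx y hy z hz (by simp [h1, h2, h4])
    obtain ⟨x, hx, y, hy, hxy, hne⟩ := hcon.2 (c p q)
    apply hne
    by_cases hyp : y = p
    · subst hyp
      by_cases hxq : x = q
      · rw [hxq, hsym]
      · exact h3 x hx y hy q hq hxy hpq hxq
    · by_cases hxp : x = p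
      · subst hxp
        by_cases hyq : y = q
        · rw [hyq]
        · rw [hsym]
          exact h3 y hy x hx q hq hyp hpq hyq
      · rw [h3 x hx y hy p hp hxy hyp hxp]
        by_cases hyq : y = q
        · rw [hyq, hsym]
        · exact h3 y hy p hp q hq hyp hpq hyq
  · push Not at hX
    exact Or.inr ⟨0, fun x hx y hy h => (h (hX x hx y hy)).elim⟩

lemma FullStars.exists_mono (h : FullStars c l A W) (hl : 27 ≤ l) (hsym : ∀ x y, c x y = c y x)
    (hno : ∀ L : List V, PCList c L → L.Nodup → L.length < l) (hW : l + 26 ≤ W.card) :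
    ∃ W' ⊆ W, FullStars c l A W' ∧ ∃ κ, ∀ x ∈ W', ∀ y ∈ W', x ≠ y → c x y = κ := by
  have key : ∀ q ≤ 3, (∃ W' ⊆ W, FullStars c l A W' ∧
      ∃ κ, ∀ x ∈ W', ∀ y ∈ W', x ≠ y → c x y = κ) ∨
      ∃ Qs : List (List V), Qs.length = q ∧ (∀ Q ∈ Qs, IsSegment c A Q) ∧ Qs.flatten.Nodup ∧
        (∀ z ∈ Qs.flatten, z ∈ W) ∧ Qs.flatten.length = 3 * q := by
    intro q hq
    induction q with
    | zero => exact Or.inr ⟨[], by simp⟩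
    | succ q ih =>
      rcases ih (by omega) with h' | ⟨Qs, hQl, hQ, hQn, hQW, hQf⟩
      · exact Or.inl h'
      · rcases exists_triple_or_mono hsym (W \ Qs.flatten.toFinset) with
          ⟨x, hx, y, hy, z, hz, hn, hc⟩ | hm
        · rw [Finset.mem_sdiff, List.mem_toFinset] at hx hy hz
          refine Or.inr ⟨[x, y, z] :: Qs, by simp [hQl], ?_, ?_, ?_, ?_⟩
          · intro Q hQ'
            rcases List.mem_cons.1 hQ' with rfl | hQ'
            · exact ⟨⟨hc, trivial⟩, ⟨x, y, [z], rfl, h.attachable hx.1 _⟩,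
                ⟨[x], y, z, rfl, h.attachable hz.1 _⟩⟩
            · exact hQ Q hQ'
          · rw [List.flatten_cons, List.nodup_append']
            refine ⟨hn, hQn, fun u hu hu' => ?_⟩
            simp only [List.mem_cons, List.not_mem_nil, or_false] at hu
            rcases hu with rfl | rfl | rfl
            exacts [hx.2 hu', hy.2 hu', hz.2 hu']
          · intro u hu
            rw [List.flatten_cons, List.mem_append] at hu
            rcases hu with hu | hu
            · simp only [List.mem_cons, List.not_mem_nil, or_false] at hu
              rcases hu with rfl | rfl | rfl
              exacts [hx.1, hy.1, hz.1]
            · exact hQW u hu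
          · rw [List.flatten_cons, List.length_append, hQf]
            simp only [List.length_cons, List.length_nil]
            omega
        · refine Or.inl ⟨_, Finset.sdiff_subset, h.mono Finset.sdiff_subset ?_, hm⟩
          have h1 := Finset.le_card_sdiff Qs.flatten.toFinset W
          have h2 := List.toFinset_card_le Qs.flatten
          omega
  rcases key 3 le_rfl with h' | ⟨Qs, hQl, hQ, hQn, hQW, hQf⟩
  · exact h'
  · have := h.flatten_length_lt hl hsym hno (by omega) hQ hQn
      (fun z hz => h.notMem z (hQW z hz)) (by omega)
    omega

end NewColors

section Surplus

variable {V : Type*} {c : V → V → ℕ} {l κ : ℕ} {A W : Finset V}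

/-- An edge of color `α` outside `A ∪ W` whose ends send no edge of color `α` to `W`. -/
structure IsInnerEdge (c : V → V → ℕ) (A W : Finset V) (α : ℕ) (z z' : V) : Prop where
  left_notMem : z ∉ A ∧ z ∉ W
  right_notMem : z' ∉ A ∧ z' ∉ W
  ne : z ≠ z'
  color : c z z' = α
  left_ne : ∀ w ∈ W, c z w ≠ α
  right_ne : ∀ w ∈ W, c z' w ≠ α

lemma IsInnerEdge.symm (hsym : ∀ x y, c x y = c y x) {α : ℕ} {z z' : V}
    (h : IsInnerEdge c A W α z z') : IsInnerEdge c A W α z' z :=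
  ⟨h.right_notMem, h.left_notMem, h.ne.symm, by rw [hsym, h.color], h.right_ne, h.left_ne⟩

/-- An edge of the new color `α` from `w ∈ W` to a vertex `z` outside `A ∪ W`. -/
structure IsBoundaryEdge (c : V → V → ℕ) (A W : Finset V) (α : ℕ) (z w : V) : Prop where
  new : IsNewColor c A α
  left_notMem : z ∉ A ∧ z ∉ W
  right_mem : w ∈ W
  color : c z w = α

lemma exists_inner_or_boundary (hsym : ∀ x y, c x y = c y x)
    (hm : ∀ x ∈ W, ∀ y ∈ W, x ≠ y → c x y = κ) {α : ℕ} (hα : α ≠ κ) (hnew : IsNewColor c A α)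
    {z z' : V} (hz : z ∉ A) (hz' : z' ∉ A) (hne : z ≠ z') (hc : c z z' = α) :
    (∃ u v, IsInnerEdge c A W α u v) ∨ ∃ u w, IsBoundaryEdge c A W α u w := by
  by_contra hcon
  push Not at hcon
  have hb : ∀ u, u ∉ A → u ∉ W → ∀ w ∈ W, c u w ≠ α := fun u hu hu' w hw e =>
    hcon.2 u w ⟨hnew, ⟨hu, hu'⟩, hw, e⟩
  by_cases h1 : z ∈ W
  · by_cases h2 : z' ∈ W
    · exact hα (by rw [← hc, hm z h1 z' h2 hne])
    · exact hb z' hz' h2 z h1 (by rw [hsym, hc])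
  · by_cases h2 : z' ∈ W
    · exact hb z hz h1 z' h2 hc
    · exact hcon.1 z z' ⟨⟨hz, h1⟩, ⟨hz', h2⟩, hne, hc, hb z hz h1, hb z' hz' h2⟩

lemma IsInnerEdge.isSegment (h : FullStars c l A W) (hsym : ∀ x y, c x y = c y x)
    {α : ℕ} {z z' w w' : V} (hi : IsInnerEdge c A W α z z') (hw : w ∈ W) (hw' : w' ∈ W) :
    IsSegment c A [w, z, z', w'] :=
  ⟨⟨by rw [hsym, hi.color]; exact hi.left_ne w hw,
      by rw [hi.color]; exact (hi.right_ne w' hw').symm, trivial⟩,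
    ⟨w, z, _, rfl, h.attachable hw _⟩, ⟨[w, z], z', w', rfl, h.attachable hw' _⟩⟩

lemma IsBoundaryEdge.isSegment (h : FullStars c l A W)
    (hm : ∀ x ∈ W, ∀ y ∈ W, x ≠ y → c x y = κ) {α : ℕ} (hα : α ≠ κ) {z w y : V}
    (hb : IsBoundaryEdge c A W α z w) (hy : y ∈ W) (hwy : w ≠ y) :
    IsSegment c A [z, w, y] :=
  ⟨⟨by rw [hb.color, hm w hb.right_mem y hy hwy]; exact hα, trivial⟩,
    ⟨z, w, _, rfl, by rw [hb.color]; exact hb.new.attachable hb.left_notMem.1⟩,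
    ⟨[z], w, y, rfl, h.attachable hy _⟩⟩

variable [DecidableEq V]

lemma FullStars.segment_length_lt (h : FullStars c l A W) (hl : 27 ≤ l)
    (hsym : ∀ x y, c x y = c y x)
    (hno : ∀ L : List V, PCList c L → L.Nodup → L.length < l) {Q : List V}
    (hQ : IsSegment c A Q) (hn : Q.Nodup) (hA : ∀ z ∈ Q, z ∉ A) (hlen : Q.length ≤ 15) :
    Q.length < l % 3 + 3 := by
  have := h.flatten_length_lt hl hsym hno (Qs := [Q]) (by simp) (by simpa using hQ)
    (by simpa using hn) (by simpa using hA) (by simpa using hlen)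
  simp at this
  omega

lemma FullStars.segment_pair_length_lt (h : FullStars c l A W) (hl : 27 ≤ l)
    (hsym : ∀ x y, c x y = c y x)
    (hno : ∀ L : List V, PCList c L → L.Nodup → L.length < l) {Q Q' : List V}
    (hQ : IsSegment c A Q) (hQ' : IsSegment c A Q') (hn : (Q ++ Q').Nodup)
    (hA : ∀ z ∈ Q ++ Q', z ∉ A) (hlen : Q.length + Q'.length ≤ 15) :
    Q.length + Q'.length < l % 3 + 5 := by
  have := h.flatten_length_lt hl hsym hno (Qs := [Q, Q']) (by simp) (by simpa using ⟨hQ, hQ'⟩)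
    (by simpa using hn) (by simpa using hA) (by simpa using hlen)
  simp at this
  omega

lemma FullStars.mod_of_innerEdge (h : FullStars c l A W) (hl : 27 ≤ l)
    (hsym : ∀ x y, c x y = c y x)
    (hno : ∀ L : List V, PCList c L → L.Nodup → L.length < l)
    {α : ℕ} {z z' : V} (hi : IsInnerEdge c A W α z z') : l % 3 = 2 := by
  obtain ⟨w, hw, -⟩ := h.exists_notMem [] (by simp)
  obtain ⟨w', hw', hww⟩ := h.exists_notMem [w] (by simp)
  have h1 := hi.left_notMem
  have h2 := hi.right_notMem
  have h3 := hi.ne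
  have h4 := h.notMem
  have := h.segment_length_lt hl hsym hno (hi.isSegment h hsym hw hw')
    (by simp at hww ⊢; grind) (by simp; grind) (by simp)
  simp at this
  omega

lemma FullStars.color_of_innerEdge (h : FullStars c l A W) (hl : 27 ≤ l)
    (hsym : ∀ x y, c x y = c y x)
    (hno : ∀ L : List V, PCList c L → L.Nodup → L.length < l)
    (hm : ∀ x ∈ W, ∀ y ∈ W, x ≠ y → c x y = κ)
    {α : ℕ} {z z' : V} (hi : IsInnerEdge c A W α z z') : ∀ w ∈ W, c z w = κ := by
  intro w hw
  by_contra hc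
  obtain ⟨y, hy, hyw⟩ := h.exists_notMem [w] (by simp)
  obtain ⟨w', hw', hww⟩ := h.exists_notMem [w, y] (by simp)
  have h1 := hi.left_notMem
  have h2 := hi.right_notMem
  have h3 := hi.ne
  have h4 := h.notMem
  have h5 := (hi.isSegment h hsym hw hw').pc
  have h6 : y ≠ w := by simpa using hyw
  have := h.segment_length_lt hl hsym hno (Q := [y, w, z, z', w'])
    ⟨⟨by rw [hm y hy w hw h6, hsym w]; exact fun e => hc e.symm, h5⟩,
      ⟨y, w, _, rfl, h.attachable hy _⟩, ⟨[y, w, z], z', w', rfl, h.attachable hw' _⟩⟩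
    (by simp at hww hyw ⊢; grind) (by simp; grind) (by simp)
  simp at this
  omega

lemma FullStars.false_of_adjacent_innerEdges (h : FullStars c l A W) (hl : 27 ≤ l)
    (hsym : ∀ x y, c x y = c y x)
    (hno : ∀ L : List V, PCList c L → L.Nodup → L.length < l)
    {α β : ℕ} (hαβ : α ≠ β) {x y z : V}
    (hi : IsInnerEdge c A W α x y) (hj : IsInnerEdge c A W β y z) : False := by
  obtain ⟨w, hw, -⟩ := h.exists_notMem [] (by simp)
  obtain ⟨w', hw', hww⟩ := h.exists_notMem [w] (by simp)
  have h1 := hi.left_notMem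
  have h2 := hi.right_notMem
  have h3 := hi.ne
  have h1' := hj.left_notMem
  have h2' := hj.right_notMem
  have h3' := hj.ne
  have h4 := h.notMem
  have hxz : x ≠ z := fun e => hαβ (by rw [← hi.color, ← hj.color, e, hsym])
  have := h.segment_length_lt hl hsym hno (Q := [w, x, y, z, w'])
    ⟨⟨by rw [hsym, hi.color]; exact hi.left_ne w hw, by rw [hi.color, hj.color]; exact hαβ,
      by rw [hj.color]; exact (hj.right_ne w' hw').symm, trivial⟩,
      ⟨w, x, _, rfl, h.attachable hw _⟩, ⟨[w, x, y], z, w', rfl, h.attachable hw' _⟩⟩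
    (by simp at hww ⊢; grind) (by simp; grind) (by simp)
  simp at this
  omega

lemma FullStars.false_of_innerEdges (h : FullStars c l A W) (hl : 27 ≤ l)
    (hsym : ∀ x y, c x y = c y x)
    (hno : ∀ L : List V, PCList c L → L.Nodup → L.length < l)
    {α β : ℕ} (hαβ : α ≠ β) {x x' z z' : V}
    (hi : IsInnerEdge c A W α x x') (hj : IsInnerEdge c A W β z z') : False := by
  have key := fun {x y z : V} => h.false_of_adjacent_innerEdges hl hsym hno hαβ
    (x := x) (y := y) (z := z)
  have n1 : x ≠ z := fun e => key (hi.symm hsym) (e ▸ hj)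
  have n2 : x ≠ z' := fun e => key (hi.symm hsym) (e ▸ hj.symm hsym)
  have n3 : x' ≠ z := fun e => key hi (e ▸ hj)
  have n4 : x' ≠ z' := fun e => key hi (e ▸ hj.symm hsym)
  obtain ⟨w, hw, -⟩ := h.exists_notMem [] (by simp)
  obtain ⟨w', hw', hww⟩ := h.exists_notMem [w] (by simp)
  obtain ⟨y, hy, hyw⟩ := h.exists_notMem [w, w'] (by simp)
  obtain ⟨y', hy', hyw'⟩ := h.exists_notMem [w, w', y] (by simp)
  have h1 := hi.left_notMem
  have h2 := hi.right_notMem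
  have h3 := hi.ne
  have h1' := hj.left_notMem
  have h2' := hj.right_notMem
  have h3' := hj.ne
  have h4 := h.notMem
  have := h.segment_pair_length_lt hl hsym hno (hi.isSegment h hsym hw hw')
    (hj.isSegment h hsym hy hy') (by simp at hww hyw hyw' ⊢; grind (splits := 30)) (by simp; grind) (by simp)
  simp at this
  omega

lemma FullStars.false_of_innerEdge_of_boundaryEdge (h : FullStars c l A W) (hl : 27 ≤ l)
    (hsym : ∀ x y, c x y = c y x)
    (hno : ∀ L : List V, PCList c L → L.Nodup → L.length < l)
    (hm : ∀ x ∈ W, ∀ y ∈ W, x ≠ y → c x y = κ)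
    {α β : ℕ} (hβ : β ≠ κ) {z z' u w : V}
    (hi : IsInnerEdge c A W α z z') (hb : IsBoundaryEdge c A W β u w) : False := by
  have hc := h.color_of_innerEdge hl hsym hno hm hi
  have hc' := h.color_of_innerEdge hl hsym hno hm (hi.symm hsym)
  have n1 : z ≠ u := fun e => hβ (by rw [← hb.color, ← e, hc w hb.right_mem])
  have n2 : z' ≠ u := fun e => hβ (by rw [← hb.color, ← e, hc' w hb.right_mem])
  obtain ⟨w', hw', hww⟩ := h.exists_notMem [w] (by simp)
  obtain ⟨y, hy, hyw⟩ := h.exists_notMem [w, w'] (by simp)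
  obtain ⟨y', hy', hyw'⟩ := h.exists_notMem [w, w', y] (by simp)
  have h1 := hi.left_notMem
  have h2 := hi.right_notMem
  have h3 := hi.ne
  have h1' := hb.left_notMem
  have h2' := hb.right_mem
  have h4 := h.notMem
  have := h.segment_pair_length_lt hl hsym hno (hi.isSegment h hsym hy hy')
    (hb.isSegment h hm hβ hw' (fun e => hww (by simp [e])))
    (by simp at hww hyw hyw' ⊢; grind (splits := 30)) (by simp; grind) (by simp)
  have := h.mod_of_innerEdge hl hsym hno hi
  simp at *
  omega

lemma FullStars.left_ne_of_boundaryEdges (h : FullStars c l A W) (hl : 27 ≤ l)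
    (hsym : ∀ x y, c x y = c y x)
    (hno : ∀ L : List V, PCList c L → L.Nodup → L.length < l)
    (hm : ∀ x ∈ W, ∀ y ∈ W, x ≠ y → c x y = κ)
    {α β : ℕ} (hα : α ≠ κ) (hβ : β ≠ κ) (hαβ : α ≠ β) {z z' w w' : V}
    (hb : IsBoundaryEdge c A W α z w) (hb' : IsBoundaryEdge c A W β z' w') : z ≠ z' := by
  rintro rfl
  have hww : w ≠ w' := fun e => hαβ (by rw [← hb.color, ← hb'.color, e])
  have hw := hb.right_mem
  have hw' := hb'.right_mem
  obtain ⟨y, hy, hyw⟩ := h.exists_notMem [w, w'] (by simp)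
  obtain ⟨y', hy', hyw'⟩ := h.exists_notMem [w, w', y] (by simp)
  have h1' := hb.left_notMem
  have h4 := h.notMem
  have e1 : c y w = κ := hm y hy w hw (fun e => hyw (by simp [e]))
  have e2 : c w' y' = κ := hm w' hw' y' hy' (fun e => hyw' (by simp [e]))
  have := h.segment_length_lt hl hsym hno (Q := [y, w, z, w', y'])
    ⟨⟨by rw [e1, hsym w, hb.color]; exact hα.symm,
      by rw [hsym w, hb.color, hb'.color]; exact hαβ,
      by rw [hb'.color, e2]; exact hβ, trivial⟩,
      ⟨y, w, _, rfl, h.attachable hy _⟩, ⟨[y, w, z], w', y', rfl, h.attachable hy' _⟩⟩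
    (by simp at hyw hyw' ⊢; grind) (by simp; grind) (by simp)
  simp at this
  omega

/-- If the color classes of two boundary colors meet in `W`, one of the classes is large. -/
lemma FullStars.three_le_card_or (h : FullStars c l A W) (hl : 27 ≤ l)
    (hsym : ∀ x y, c x y = c y x)
    (hno : ∀ L : List V, PCList c L → L.Nodup → L.length < l)
    {α β : ℕ} (hαβ : α ≠ β) {z z' w : V} (hzz : z ≠ z')
    (hb : IsBoundaryEdge c A W α z w) (hb' : IsBoundaryEdge c A W β z' w) :
    3 ≤ (W.filter fun w => c z w = α).card ∨ 3 ≤ (W.filter fun w => c z' w = β).card := by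
  by_contra hcon
  push Not at hcon
  obtain ⟨y, hy, hyF⟩ := h.exists_notMem (W.filter fun w => c z w = α).toList (by
    rw [Finset.length_toList]; omega)
  obtain ⟨y', hy', hyF'⟩ := h.exists_notMem (y :: (W.filter fun w => c z' w = β).toList) (by
    rw [List.length_cons, Finset.length_toList]; omega)
  simp only [List.mem_cons, Finset.mem_toList, Finset.mem_filter, not_or, not_and] at hyF hyF'
  have hyc := hyF hy
  have hyc' := hyF'.2 hy'
  have n1 : y ≠ w := fun e => hyc (e ▸ hb.color)
  have n2 : y' ≠ w := fun e => hyc' (e ▸ hb'.color)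
  have n3 := hyF'.1
  have h1 := hb.left_notMem
  have h2 := hb'.left_notMem
  have h3 := hb.right_mem
  have h4 := h.notMem
  have := h.segment_length_lt hl hsym hno (Q := [y, z, w, z', y'])
    ⟨⟨by rw [hsym, hb.color]; exact hyc, by rw [hsym w, hb.color, hb'.color]; exact hαβ,
      by rw [hsym, hb'.color]; exact fun e => hyc' e.symm, trivial⟩,
      ⟨y, z, _, rfl, h.attachable hy _⟩, ⟨[y, z, w], z', y', rfl, h.attachable hy' _⟩⟩
    (by simp; grind) (by simp; grind) (by simp)
  simp at this
  omega

lemma FullStars.exists_injective_boundary (h : FullStars c l A W) (hl : 27 ≤ l)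
    (hsym : ∀ x y, c x y = c y x)
    (hno : ∀ L : List V, PCList c L → L.Nodup → L.length < l)
    {e : ℕ} (he : e ≤ 3) {α : Fin e → ℕ} (hα : Function.Injective α) {z : Fin e → V}
    (hz : Function.Injective z) (hb : ∀ i, ∃ w, IsBoundaryEdge c A W (α i) (z i) w) :
    ∃ w : Fin e → V, Function.Injective w ∧ ∀ i, IsBoundaryEdge c A W (α i) (z i) (w i) := by
  have hne : ∀ i, (W.filter fun w => c (z i) w = α i).Nonempty := fun i => by
    obtain ⟨w, hw⟩ := hb i
    exact ⟨w, Finset.mem_filter.2 ⟨hw.right_mem, hw.color⟩⟩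
  have hall : ∀ s : Finset (Fin e),
      s.card ≤ (s.biUnion fun i => W.filter fun w => c (z i) w = α i).card := by
    intro s
    by_cases hbig : ∃ i ∈ s, 3 ≤ (W.filter fun w => c (z i) w = α i).card
    · obtain ⟨i, hi, hi3⟩ := hbig
      have h1 := Finset.card_le_card (Finset.subset_biUnion_of_mem
        (fun i => W.filter fun w => c (z i) w = α i) hi)
      have h2 := Finset.card_le_univ s
      rw [Fintype.card_fin] at h2
      omega
    · push Not at hbig
      rw [Finset.card_biUnion, Finset.card_eq_sum_ones]
      · exact Finset.sum_le_sum fun i _ => Finset.card_pos.2 (hne i)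
      · intro i hi j hj hij
        refine Finset.disjoint_left.2 ?_
        intro w hw hw'
        rw [Finset.mem_filter] at hw hw'
        obtain ⟨_, hbi⟩ := hb i
        obtain ⟨_, hbj⟩ := hb j
        rcases h.three_le_card_or hl hsym hno (fun e => hij (hα e)) (fun e => hij (hz e))
          ⟨hbi.new, hbi.left_notMem, hw.1, hw.2⟩ ⟨hbj.new, hbj.left_notMem, hw'.1, hw'.2⟩ with h' | h'
        · exact (hbig i hi).not_ge h'
        · exact (hbig j hj).not_ge h'
  obtain ⟨w, hw, hwm⟩ := (Finset.all_card_le_biUnion_card_iff_exists_injective _).1 hall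
  refine ⟨w, hw, fun i => ?_⟩
  obtain ⟨_, hbi⟩ := hb i
  have hwi := Finset.mem_filter.1 (hwm i)
  exact ⟨hbi.new, hbi.left_notMem, hwi.1, hwi.2⟩

lemma FullStars.false_of_boundaryEdges (h : FullStars c l A W) (hl : 27 ≤ l)
    (hsym : ∀ x y, c x y = c y x)
    (hno : ∀ L : List V, PCList c L → L.Nodup → L.length < l)
    (hm : ∀ x ∈ W, ∀ y ∈ W, x ≠ y → c x y = κ)
    {α : Fin (l % 3 + 1) → ℕ} (hακ : ∀ i, α i ≠ κ) (hα : Function.Injective α)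
    (hb : ∀ i, ∃ z w, IsBoundaryEdge c A W (α i) z w) : False := by
  choose z hz using hb
  have he : l % 3 + 1 ≤ 3 := by omega
  have hzi : Function.Injective z := fun i j hij => by
    by_contra hne
    obtain ⟨w, hw⟩ := hz i
    obtain ⟨w', hw'⟩ := hz j
    exact h.left_ne_of_boundaryEdges hl hsym hno hm (hακ i) (hακ j) (fun e => hne (hα e)) hw hw'
      hij
  obtain ⟨w, hw, hwb⟩ := h.exists_injective_boundary hl hsym hno he hα hzi hz
  obtain ⟨y, hyi, hyW⟩ : ∃ y : Fin (l % 3 + 1) → V, Function.Injective y ∧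
      ∀ i, y i ∈ W \ Finset.univ.image w := by
    have h1 := Finset.le_card_sdiff (Finset.univ.image w) W
    have h2 : (Finset.univ.image w).card ≤ l % 3 + 1 :=
      Finset.card_image_le.trans (by simp)
    have h3 := h.card_le
    obtain ⟨f⟩ := Function.Embedding.nonempty_of_card_le (α := Fin (l % 3 + 1))
      (β := (W \ Finset.univ.image w : Finset V)) (by simp; omega)
    exact ⟨fun i => f i, fun i j hij => f.injective (Subtype.ext hij), fun i => (f i).2⟩
  have hyW' : ∀ i, y i ∈ W ∧ ∀ j, w j ≠ y i := fun i => by simpa using hyW i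
  have hmem : ∀ {u i}, u ∈ [z i, w i, y i] → u = z i ∨ u = w i ∨ u = y i := by simp
  have h4 := h.notMem
  have := h.flatten_length_lt hl hsym hno
    (Qs := (List.finRange (l % 3 + 1)).map fun i => [z i, w i, y i]) (by simp; omega) ?_ ?_ ?_ ?_
  · simp [Function.comp_def] at this
    omega
  · intro Q hQ
    obtain ⟨i, -, rfl⟩ := List.mem_map.1 hQ
    exact (hwb i).isSegment h hm (hακ i) (hyW' i).1 ((hyW' i).2 i)
  · rw [← List.flatMap_def, List.nodup_flatMap]
    refine ⟨fun i _ => ?_, (List.nodup_finRange _).imp ?_⟩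
    · have := (hwb i).left_notMem
      have := (hwb i).right_mem
      have := hyW' i
      simp
      grind
    · intro i j hij u hu hu'
      have := (hwb i).left_notMem
      have := (hwb i).right_mem
      have := hyW' i
      have := (hwb j).left_notMem
      have := (hwb j).right_mem
      have := hyW' j
      have := hw.ne hij
      have := hzi.ne hij
      have := hyi.ne hij
      rcases hmem hu with rfl | rfl | rfl <;> rcases hmem hu' with hu' | hu' | hu' <;> grind
  · intro u hu
    obtain ⟨Q, hQ, hu⟩ := List.mem_flatten.1 hu
    obtain ⟨i, -, rfl⟩ := List.mem_map.1 hQ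
    rcases hmem hu with rfl | rfl | rfl
    exacts [(hwb i).left_notMem.1, h4 _ (hwb i).right_mem, h4 _ (hyW' i).1]
  · simp [Function.comp_def]
    omega

/-- At most `l % 3 + 1` colors occur only away from `A`. -/
lemma FullStars.card_newColors_le (h : FullStars c l A W) (hl : 27 ≤ l)
    (hsym : ∀ x y, c x y = c y x)
    (hno : ∀ L : List V, PCList c L → L.Nodup → L.length < l) (hW : l + 26 ≤ W.card)
    {T : Finset ℕ} (hT : ∀ α ∈ T, IsNewColor c A α ∧
      ∃ z z', z ∉ A ∧ z' ∉ A ∧ z ≠ z' ∧ c z z' = α) : T.card ≤ l % 3 + 1 := by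
  obtain ⟨W, -, h, κ, hm⟩ := h.exists_mono hl hsym hno hW
  by_contra! hcard
  have hcases : ∀ α ∈ T.erase κ, (∃ u v, IsInnerEdge c A W α u v) ∨
      ∃ u w, IsBoundaryEdge c A W α u w := fun α hα => by
    rw [Finset.mem_erase] at hα
    obtain ⟨hnew, z, z', hz, hz', hne, hc⟩ := hT α hα.2
    exact exists_inner_or_boundary hsym hm hα.1 hnew hz hz' hne hc
  have hce : l % 3 + 1 ≤ (T.erase κ).card := by
    have := Finset.pred_card_le_card_erase (s := T) (a := κ)
    omega
  by_cases hin : ∃ α ∈ T.erase κ, ∃ u v, IsInnerEdge c A W α u v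
  · obtain ⟨α, hα, u, v, hi⟩ := hin
    have h2 := h.mod_of_innerEdge hl hsym hno hi
    obtain ⟨β, hβ, hne⟩ := Finset.exists_mem_ne (show 1 < (T.erase κ).card by omega) α
    rcases hcases β hβ with ⟨u', v', hj⟩ | ⟨u', v', hj⟩
    · exact h.false_of_innerEdges hl hsym hno hne.symm hi hj
    · exact h.false_of_innerEdge_of_boundaryEdge hl hsym hno hm (Finset.mem_erase.1 hβ).1 hi hj
  · obtain ⟨f⟩ := Function.Embedding.nonempty_of_card_le (α := Fin (l % 3 + 1))
      (β := (T.erase κ : Finset ℕ)) (by simpa using hce)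
    refine h.false_of_boundaryEdges hl hsym hno hm (α := fun i => f i)
      (fun i => (Finset.mem_erase.1 (f i).2).1)
      (fun i j hij => f.injective (Subtype.ext hij)) fun i => ?_
    exact (hcases _ (f i).2).resolve_left fun hx => hin ⟨_, (f i).2, hx⟩

end Surplus

section Edges

variable {V : Type*} {c : V → V → ℕ} {l : ℕ}

/-- The coloring of unordered pairs induced by the symmetric function `c`. -/
def edgeColor (c : V → V → ℕ) (hsym : ∀ x y, c x y = c y x) : Sym2 V → ℕ :=
  Sym2.lift ⟨c, hsym⟩

@[simp] lemma edgeColor_mk (hsym : ∀ x y, c x y = c y x) (x y : V) :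
    edgeColor c hsym s(x, y) = c x y := rfl

lemma exists_representatives {hsym : ∀ x y, c x y = c y x} (X : Finset (Sym2 V)) :
    ∃ E ⊆ X, Set.InjOn (edgeColor c hsym) E ∧
      E.image (edgeColor c hsym) = X.image (edgeColor c hsym) := by
  obtain ⟨E, hE, hi, him⟩ := Finset.exists_subset_injOn_image_eq_of_surjOn
    (f := edgeColor c hsym) (X : Set (Sym2 V)) (X.image (edgeColor c hsym)) (by
      rw [Finset.coe_image]
      exact Set.surjOn_image _ _)
  exact ⟨E, by exact_mod_cast hE, hi, him⟩

lemma choose_two_add (m a : ℕ) :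
    (m + a).choose 2 + (a + 1).choose 2 = m.choose 2 + a * (m + a) := by
  induction a with
  | zero => simp
  | succ a ih =>
    have h1 : (m + (a + 1)).choose 2 = (m + a) + (m + a).choose 2 := by
      rw [← add_assoc, Nat.choose_succ_succ' (m + a) 1, Nat.choose_one_right]
    have h2 : (a + 1 + 1).choose 2 = (a + 1) + (a + 1).choose 2 := by
      rw [Nat.choose_succ_succ' (a + 1) 1, Nat.choose_one_right]
    rw [h1, h2]
    linarith

variable [Fintype V] [DecidableEq V]

/-- The edges of the complete graph on `V`. -/
def completeEdges (V : Type*) [Fintype V] [DecidableEq V] : Finset (Sym2 V) :=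
  (Finset.univ : Finset V).offDiag.image (Function.uncurry Sym2.mk)

lemma mk_mem_completeEdges {x y : V} : s(x, y) ∈ completeEdges V ↔ x ≠ y := by
  simp only [completeEdges, Finset.mem_image, Finset.mem_offDiag, Finset.mem_univ, true_and,
    Prod.exists, Function.uncurry_apply_pair, Sym2.eq_iff]
  constructor
  · rintro ⟨a, b, hab, ⟨rfl, rfl⟩ | ⟨rfl, rfl⟩⟩
    exacts [hab, hab.symm]
  · exact fun h => ⟨x, y, h, Or.inl ⟨rfl, rfl⟩⟩

lemma card_edgesAvoiding_completeEdges (A : Finset V) :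
    (edgesAvoiding (completeEdges V) A).card = (Fintype.card V - A.card).choose 2 := by
  rw [← Finset.card_compl, ← Sym2.card_image_offDiag]
  congr 1
  ext e
  induction e using Sym2.ind with | _ x y =>
  simp only [mk_mem_edgesAvoiding, mk_mem_completeEdges, Finset.mem_image, Finset.mem_offDiag,
    Finset.mem_compl, Prod.exists, Function.uncurry_apply_pair, Sym2.eq_iff]
  constructor
  · exact fun h => ⟨x, y, ⟨h.2.1, h.2.2, h.1⟩, Or.inl ⟨rfl, rfl⟩⟩
  · rintro ⟨a, b, h, ⟨rfl, rfl⟩ | ⟨rfl, rfl⟩⟩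
    exacts [⟨h.2.2, h.1, h.2.1⟩, ⟨h.2.2.symm, h.2.1, h.1⟩]

lemma card_touching_add (A : Finset V) :
    (completeEdges V \ edgesAvoiding (completeEdges V) A).card + (A.card + 1).choose 2 =
      A.card * Fintype.card V := by
  have h1 := Finset.card_sdiff_add_card_eq_card (edgesAvoiding_subset (completeEdges V) A)
  have h2 : (completeEdges V).card = (Fintype.card V).choose 2 :=
    Sym2.card_image_offDiag _
  have h3 := choose_two_add (Fintype.card V - A.card) A.card
  rw [Nat.sub_add_cancel (Finset.card_le_univ A)] at h3
  rw [card_edgesAvoiding_completeEdges, h2] at h1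
  omega

lemma card_le_card_edgesAvoiding_add {E : Finset (Sym2 V)} (hE : E ⊆ completeEdges V)
    (A : Finset V) : E.card ≤ (edgesAvoiding E A).card + A.card * Fintype.card V := by
  have hsub : E ⊆ edgesAvoiding E A ∪ (completeEdges V \ edgesAvoiding (completeEdges V) A) := by
    intro e he
    induction e using Sym2.ind with | _ x y =>
    simp only [Finset.mem_union, Finset.mem_sdiff, mk_mem_edgesAvoiding]
    have := hE he
    tauto
  have h1 := (Finset.card_le_card hsub).trans (Finset.card_union_le _ _)
  have h2 := card_touching_add A
  omega

variable {hsym : ∀ x y, c x y = c y x} {E : Finset (Sym2 V)}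

lemma false_of_high_degree (hno : ∀ L : List V, PCList c L → L.Nodup → L.length < l)
    (hinj : Set.InjOn (edgeColor c hsym) E) {A : Finset V}
    (hA : A.card = l / 3) (hl : 3 ≤ l)
    (hdeg : ∀ a ∈ A, l + l / 3 + 5 ≤ (E.filter (a ∈ ·)).card) : False := by
  have hRS : RainbowStars c l A (fun a => Finset.univ.filter fun x => x ∉ A ∧ s(a, x) ∈ E)
      {z | z ∈ A} := by
    refine ⟨fun a ha a' ha' x hx x' hx' e => ?_, fun a ha x hx hx' => ?_, fun a ha => ?_⟩
    · rw [Finset.mem_filter] at hx hx'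
      rcases Sym2.eq_iff.1 (hinj hx.2.2 hx'.2.2 (by simpa using e)) with h | h
      · exact h
      · exact (hx'.2.1 (h.1 ▸ ha)).elim
    · exact (Finset.mem_filter.1 hx).2.1 hx'
    · have hsub : E.filter (a ∈ ·) ⊆ (A ∪ Finset.univ.filter fun x => x ∉ A ∧ s(a, x) ∈ E).image
          fun x => s(a, x) := by
        intro e he
        rw [Finset.mem_filter] at he
        obtain ⟨y, rfl⟩ := Sym2.mem_iff_exists.1 he.2
        refine Finset.mem_image.2 ⟨y, ?_, rfl⟩
        by_cases hy : y ∈ A <;> simp [hy, he.1]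
      have h1 := (Finset.card_le_card hsub).trans Finset.card_image_le
      have h2 := h1.trans (Finset.card_union_le _ _)
      have h3 := hdeg a ha
      omega
  have hfl : (A.toList.map fun a => [a]).flatten = A.toList := by
    rw [← List.flatMap_def, List.flatMap_singleton']
  have := hRS.flatten_length_lt hsym hno (Bs := A.toList.map fun a => [a]) ?_ ?_ ?_ ?_
  · rw [hfl, List.length_map, Finset.length_toList] at this
    omega
  · intro e
    have := congrArg List.length e
    rw [List.length_map, Finset.length_toList, List.length_nil] at this
    omega
  · intro b hb
    obtain ⟨a, ha, rfl⟩ := List.mem_map.1 hb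
    rw [Finset.mem_toList] at ha
    exact ⟨trivial, ⟨a, ha, [], rfl⟩, ⟨a, ha, [], rfl⟩⟩
  · rw [hfl]
    exact A.nodup_toList
  · intro z hz
    rwa [hfl, Finset.mem_toList] at hz

lemma card_edgesAvoiding_le (hno : ∀ L : List V, PCList c L → L.Nodup → L.length < l)
    (hE : E ⊆ completeEdges V) (hinj : Set.InjOn (edgeColor c hsym) E) {A : Finset V}
    {Δ : ℕ} (hdeg : ∀ v, v ∉ A → (E.filter (v ∈ ·)).card ≤ Δ) (hl : 2 ≤ l) :
    (edgesAvoiding E A).card ≤ Δ * (l * (l - 1)) := by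
  by_contra! hcon
  obtain ⟨v, u, t, hpc, hnd, hlen, -⟩ := exists_path_of_card_edgesAvoiding hsym
    (fun x hx => mk_mem_completeEdges.1 (hE hx) rfl)
    (fun x y x' y' h h' e => hinj h h' (by simpa using e)) hdeg (l - 2) A subset_rfl (by
      rwa [show l - 2 + 2 = l by omega, show l - 2 + 1 = l - 1 by omega])
  have := hno _ hpc hnd
  omega

/-- The case where the representing graph has exactly `l / 3 - 1` vertices of large degree. -/
lemma card_colors_le_of_card_add_one (hl : 27 ≤ l) (hn : 2 * l ^ 3 ≤ Fintype.card V)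
    (hno : ∀ L : List V, PCList c L → L.Nodup → L.length < l)
    (hE : E ⊆ completeEdges V)
    (him : E.image (edgeColor c hsym) = (completeEdges V).image (edgeColor c hsym))
    {A : Finset V} (hA : A.card + 1 = l / 3)
    (hcard : (edgesAvoiding E A).card + 2 * l ^ 2 ≤ 2 * l ^ 3) :
    ((completeEdges V).image (edgeColor c hsym)).card ≤
      (completeEdges V \ edgesAvoiding (completeEdges V) A).card + 1 + l % 3 := by
  set X := completeEdges V with hX
  set S := X \ edgesAvoiding X A with hS
  set col := edgeColor c hsym with hcol
  set T := X.image col \ S.image col with hT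
  obtain ⟨F, hFS, hFinj, hFim⟩ := exists_representatives (hsym := hsym) S
  rw [← hcol] at hFinj hFim
  have hFcard : F.card = (S.image col).card := by
    rw [← hFim, Finset.card_image_of_injOn hFinj]
  have hTcard : T.card + F.card = (X.image col).card := by
    rw [hFcard]
    exact Finset.card_sdiff_add_card_eq_card (Finset.image_subset_image Finset.sdiff_subset)
  have hSmem : ∀ {a x : V}, a ∈ A → x ∉ A → s(a, x) ∈ S := fun {a x} ha hx => by
    simp only [hS, Finset.mem_sdiff, mk_mem_edgesAvoiding, hX, mk_mem_completeEdges]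
    exact ⟨fun e => hx (e ▸ ha), fun h => h.2.1 ha⟩
  by_contra! hcon
  have hTle : T.card ≤ (edgesAvoiding E A).card := by
    refine le_trans (Finset.card_le_card ?_) (Finset.card_image_le (f := col))
    intro α hα
    rw [hT, Finset.mem_sdiff, ← him, Finset.mem_image] at hα
    obtain ⟨⟨e, he, rfl⟩, hα⟩ := hα
    refine Finset.mem_image_of_mem _ (by_contra fun he' => hα (Finset.mem_image_of_mem _ ?_))
    induction e using Sym2.ind with | _ x y =>
    simp only [hS, Finset.mem_sdiff, mk_mem_edgesAvoiding] at he' ⊢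
    have := hE he
    tauto
  have hnon : (S \ F).card + F.card = S.card := Finset.card_sdiff_add_card_eq_card hFS
  set W : Finset V := Finset.univ.filter fun w => w ∉ A ∧ ∀ a ∈ A, s(a, w) ∈ F with hW
  have hWmem : ∀ {w}, w ∈ W ↔ w ∉ A ∧ ∀ a ∈ A, s(a, w) ∈ F := by simp [hW]
  have hWcard : (Finset.univ \ (A ∪ W)).card ≤ (S \ F).card := by
    have hbad : ∀ w ∈ Finset.univ \ (A ∪ W), ∃ a ∈ A, s(a, w) ∉ F := by
      intro w hw
      simp only [Finset.mem_sdiff, Finset.mem_univ, true_and, Finset.mem_union, hWmem] at hw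
      by_contra! h
      exact hw (by tauto)
    choose! f hf hfF using hbad
    have hout : ∀ w ∈ Finset.univ \ (A ∪ W), w ∉ A := fun w hw h => by simp [h] at hw
    refine Finset.card_le_card_of_injOn (fun w => s(f w, w)) (fun w hw => ?_)
      fun w hw w' hw' e => ?_
    · exact Finset.mem_sdiff.2 ⟨hSmem (hf w hw) (hout w hw), hfF w hw⟩
    · rcases Sym2.eq_iff.1 e with h | h
      · exact h.2
      · exact (hout w' hw' (h.1 ▸ hf w hw)).elim
  have hWlarge : l + 26 ≤ W.card := by
    have h1 := Finset.le_card_sdiff (A ∪ W) Finset.univ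
    have h2 := Finset.card_union_le A W
    rw [Finset.card_univ] at h1
    have h3 : 3 * l ≤ 2 * l ^ 2 := by nlinarith
    omega
  have hstars : FullStars c l A W :=
    { card_add_one := hA
      eq_of_color_eq := fun a ha a' ha' x hx x' hx' e => by
        rw [hWmem] at hx hx'
        rcases Sym2.eq_iff.1 (hFinj (hx.2 a ha) (hx'.2 a' ha') (by simpa [hcol] using e)) with
          h | h
        · exact h
        · exact (hx'.1 (h.1 ▸ ha)).elim
      notMem := fun x hx => (hWmem.1 hx).1
      card_le := by omega }
  have := hstars.card_newColors_le hl hsym hno hWlarge (T := T) fun α hα => by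
    rw [hT, Finset.mem_sdiff, Finset.mem_image] at hα
    obtain ⟨⟨e, he, rfl⟩, hα⟩ := hα
    refine ⟨fun a ha u hu e' => hα ?_, ?_⟩
    · rw [← e', ← edgeColor_mk hsym]
      exact Finset.mem_image_of_mem _ (hSmem ha hu)
    · induction e using Sym2.ind with | _ x y =>
      have hav : s(x, y) ∈ edgesAvoiding X A := by
        by_contra h
        exact hα (Finset.mem_image_of_mem _ (Finset.mem_sdiff.2 ⟨he, h⟩))
      rw [mk_mem_edgesAvoiding] at hav
      exact ⟨x, y, hav.2.1, hav.2.2, mk_mem_completeEdges.1 he, rfl⟩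
  omega

/-- The upper bound on the number of colors. -/
lemma card_colors_le (hl : 27 ≤ l) (hn : 2 * l ^ 3 ≤ Fintype.card V)
    (hno : ∀ L : List V, PCList c L → L.Nodup → L.length < l) :
    ((completeEdges V).image (edgeColor c hsym)).card ≤
      (l / 3 - 1) * Fintype.card V - (l / 3).choose 2 + 1 + l % 3 := by
  obtain ⟨E, hE, hinj, him⟩ := exists_representatives (hsym := hsym) (completeEdges V)
  have hcol : E.card = ((completeEdges V).image (edgeColor c hsym)).card := by
    rw [← him, Finset.card_image_of_injOn hinj]
  set A : Finset V := Finset.univ.filter fun v => l + l / 3 + 5 ≤ (E.filter (v ∈ ·)).card with hA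
  have hdeg : ∀ v, v ∉ A → (E.filter (v ∈ ·)).card ≤ 2 * l := fun v hv => by
    simp only [hA, Finset.mem_filter, Finset.mem_univ, true_and] at hv
    omega
  have hsparse := card_edgesAvoiding_le hno hE hinj hdeg (by omega)
  have hsq : 2 * l * (l * (l - 1)) + 2 * l ^ 2 = 2 * l ^ 3 := by
    obtain ⟨m, rfl⟩ : ∃ m, l = m + 1 := ⟨l - 1, by omega⟩
    rw [Nat.add_sub_cancel]
    ring
  have hAle : A.card < l / 3 := by
    by_contra! h
    obtain ⟨A', hA', hc⟩ := Finset.exists_subset_card_eq h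
    exact false_of_high_degree hno hinj hc (by omega) fun a ha =>
      (Finset.mem_filter.1 (hA' ha)).2
  rcases Nat.lt_or_ge (A.card + 1) (l / 3) with h | h
  · have h1 := card_le_card_edgesAvoiding_add hE A
    have h2 : A.card * Fintype.card V + Fintype.card V ≤ (l / 3 - 1) * Fintype.card V := by
      rw [← Nat.succ_mul]
      exact Nat.mul_le_mul_right _ (by omega)
    have h3 : (l / 3).choose 2 ≤ l ^ 2 :=
      (Nat.choose_le_pow _ _).trans (Nat.pow_le_pow_left (Nat.div_le_self _ _) 2)
    omega
  · have hc : A.card + 1 = l / 3 := by omega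
    have h1 := card_colors_le_of_card_add_one hl hn hno hE him hc (by omega)
    have h2 := card_touching_add A
    rw [hc, show A.card = l / 3 - 1 by omega] at h2
    omega

end Edges

section Extremal

/-- The extremal coloring: an edge meeting `{0, …, a - 1}` has a color of its own, and any other
edge is colored by its smaller endpoint, truncated at `a + r`. -/
def extremalColor (a r u v : ℕ) : ℕ :=
  if min u v < a then Nat.pair (min u v) (max u v) + a + r + 1 else min (min u v) (a + r)

lemma extremalColor_comm (a r u v : ℕ) : extremalColor a r u v = extremalColor a r v u := by
  simp only [extremalColor, min_comm u v, max_comm u v]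

lemma PCList.length_le_of_forall_le {a r : ℕ} (N : ℕ) : ∀ L : List ℕ, L.length = N →
    PCList (extremalColor a r) L → (∀ x ∈ L, a ≤ x) →
    L.length ≤ 2 + L.countP (· < a + r) := by
  induction N using Nat.strong_induction_on with | _ N ih =>
  intro L hN hL ha
  by_cases hlow : ∃ x ∈ L, x < a + r
  · obtain ⟨m, hm, hmin⟩ := L.toFinset.exists_min_image id
      (hlow.imp fun x hx => List.mem_toFinset.2 hx.1)
    simp only [List.mem_toFinset, id] at hm hmin
    have hmr : m < a + r := by
      obtain ⟨x, hx, hxr⟩ := hlow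
      exact (hmin x hx).trans_lt hxr
    obtain ⟨s, t, rfl⟩ := List.append_of_mem hm
    rcases List.eq_nil_or_concat s with rfl | ⟨s, x, rfl⟩
    · have := ih t.length (by simp at hN; omega) t rfl hL.tail
        (fun x hx => ha x (by simp [hx]))
      simp [hmr]
      omega
    · rcases t with _ | ⟨y, t⟩
      · have := ih (s.concat x).length (by simp at hN ⊢; omega) _ rfl hL.append_left
          (fun x hx => ha x (by simp at hx ⊢; tauto))
        simp [List.countP_append, List.countP_cons, hmr] at this ⊢
        omega
      · have h := PCList.append_right (s := s) (t := x :: m :: y :: t) (by simpa using hL)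
        refine absurd ?_ h.1
        have h1 := hmin x (by simp)
        have h2 := hmin y (by simp)
        have h3 := ha m (by simp)
        simp [extremalColor, h1, h2, h3.not_gt]
  · push Not at hlow
    match L with
    | [] => simp
    | [_] => exact Nat.le_add_right_of_le (by simp)
    | [_, _] => simp
    | x :: y :: z :: t =>
      refine absurd ?_ hL.1
      have h1 := hlow x (by simp)
      have h2 := hlow y (by simp)
      have h3 := hlow z (by simp)
      simp only [extremalColor]
      rw [if_neg (by omega), if_neg (by omega)]
      omega

lemma PCList.length_le_countP {a r : ℕ} (N : ℕ) : ∀ L : List ℕ, L.length = N →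
    PCList (extremalColor a r) L →
    L.length ≤ 3 * L.countP (· < a) + 2 + L.countP (fun x => a ≤ x ∧ x < a + r) := by
  induction N using Nat.strong_induction_on with | _ N ih =>
  intro L hN hL
  by_cases hlow : ∃ x ∈ L, x < a
  · obtain ⟨m, hm, hma⟩ := hlow
    obtain ⟨s, t, rfl⟩ := List.append_of_mem hm
    simp only [List.length_append, List.length_cons] at hN
    have h1 := ih s.length (by omega) s rfl hL.append_left
    have h2 := ih t.length (by omega) t rfl hL.append_right.tail
    simp only [List.length_append, List.length_cons, List.countP_append, List.countP_cons, hma,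
      hma.not_ge, decide_true, if_true, false_and, decide_false]
    omega
  · push Not at hlow
    have h := PCList.length_le_of_forall_le N L hN hL hlow
    have : L.countP (· < a + r) = L.countP (fun x => a ≤ x ∧ x < a + r) :=
      List.countP_congr fun x hx => by simp [hlow x hx]
    omega

lemma List.Nodup.countP_le_card {L : List ℕ} (hL : L.Nodup) (p : ℕ → Bool) (S : Finset ℕ)
    (hS : ∀ x, p x → x ∈ S) : L.countP p ≤ S.card := by
  rw [List.countP_eq_length_filter, ← List.toFinset_card_of_nodup (hL.filter p)]
  exact Finset.card_le_card fun x hx => hS x (by simp at hx; exact hx.2)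

lemma PCList.length_le_of_extremalColor {a r : ℕ} {L : List ℕ} (hL : PCList (extremalColor a r) L)
    (hn : L.Nodup) : L.length ≤ 3 * a + 2 + r := by
  have h := PCList.length_le_countP _ L rfl hL
  have h1 := hn.countP_le_card (· < a) (Finset.range a) (by simp)
  have h2 := hn.countP_le_card (fun x => a ≤ x ∧ x < a + r) (Finset.Ico a (a + r)) (by simp)
  simp only [Finset.card_range, Nat.card_Ico] at h1 h2
  omega

variable {n l : ℕ}

lemma not_hasPCPath_extremalColor {a r : ℕ} (hl : 3 * a + 2 + r < l) :
    ¬ HasPCPath n l fun i j => extremalColor a r i j := by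
  rintro ⟨p, hp, hc⟩
  have h := PCList.length_le_of_extremalColor (a := a) (r := r)
    (L := List.ofFn fun i => (p i : ℕ))
    (pcList_of_getElem_ne fun i hi => by simpa using hc i (by simpa using hi))
    (List.nodup_ofFn.2 (Fin.val_injective.comp hp))
  rw [List.length_ofFn] at h
  omega

lemma length_lt_of_not_hasPCPath {c : Fin n → Fin n → ℕ} (h : ¬ HasPCPath n l c)
    (L : List (Fin n)) (hL : PCList c L) (hn : L.Nodup) : L.length < l := by
  by_contra! hlen
  refine h ⟨fun i => L[i], fun i j hij => Fin.ext ?_, fun i hi => hL.getElem_ne i (by omega)⟩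
  exact (hn.getElem_inj_iff).1 hij

lemma colorsUsed_eq {c : Fin n → Fin n → ℕ} (hsym : ∀ i j, c i j = c j i) :
    colorsUsed n c = ((completeEdges (Fin n)).image (edgeColor c hsym)).card := by
  rw [colorsUsed, completeEdges, Finset.image_image]
  congr 2
  ext p
  simp

lemma le_colorsUsed_extremalColor {a r : ℕ} (hn : a + r + 2 ≤ n) :
    a * n - (a + 1).choose 2 + 1 + r ≤
      colorsUsed n fun i j : Fin n => extremalColor a r i j := by
  set A : Finset (Fin n) := Finset.univ.filter fun i => (i : ℕ) < a with hA
  have hAc : A.card = a := by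
    rw [hA, Fin.card_filter_val_lt]
    omega
  have hsym : ∀ i j : Fin n, extremalColor a r i j = extremalColor a r j i :=
    fun i j => extremalColor_comm a r i j
  rw [colorsUsed_eq hsym]
  set T := completeEdges (Fin n) \ edgesAvoiding (completeEdges (Fin n)) A with hT
  have hTc := card_touching_add A
  rw [hAc, Fintype.card_fin, ← hT] at hTc
  have hTA : ∀ x y : Fin n, s(x, y) ∈ T → min (x : ℕ) y < a := fun x y hxy => by
    simp only [hT, Finset.mem_sdiff, mk_mem_edgesAvoiding, hA, Finset.mem_filter,
      Finset.mem_univ, true_and] at hxy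
    by_contra hlt
    exact hxy.2 ⟨hxy.1, by omega, by omega⟩
  have hinj : Set.InjOn (edgeColor _ hsym) (T : Set (Sym2 (Fin n))) := by
    intro e he f hf hef
    induction e using Sym2.ind with | _ x y =>
    induction f using Sym2.ind with | _ z w =>
    have h1 := hTA x y he
    have h2 := hTA z w hf
    simp only [edgeColor_mk, extremalColor, h1, h2, if_true, Nat.add_right_cancel_iff,
      Nat.pair_eq_pair] at hef
    rw [Sym2.eq_iff]
    simp only [Fin.ext_iff]
    omega
  have hdisj : Disjoint (T.image (edgeColor _ hsym)) (Finset.Icc a (a + r)) := by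
    rw [Finset.disjoint_left]
    intro m hm hm'
    obtain ⟨e, he, rfl⟩ := Finset.mem_image.1 hm
    induction e using Sym2.ind with | _ x y =>
    simp only [edgeColor_mk, extremalColor, hTA x y he, if_true, Finset.mem_Icc] at hm'
    omega
  have hsub : T.image (edgeColor _ hsym) ∪ Finset.Icc a (a + r) ⊆
      (completeEdges (Fin n)).image (edgeColor _ hsym) := by
    refine Finset.union_subset (Finset.image_subset_image Finset.sdiff_subset) fun m hm => ?_
    rw [Finset.mem_Icc] at hm
    refine Finset.mem_image.2 ⟨s(⟨m, by omega⟩, ⟨n - 1, by omega⟩), ?_, ?_⟩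
    · rw [mk_mem_completeEdges, Ne, Fin.mk.injEq]
      omega
    · simp only [edgeColor_mk, extremalColor]
      rw [if_neg (by omega)]
      omega
  have h := Finset.card_le_card hsub
  rw [Finset.card_union_of_disjoint hdisj, Finset.card_image_of_injOn hinj, Nat.card_Icc] at h
  omega

lemma colorsUsed_le (hl : 27 ≤ l) (hn : 2 * l ^ 3 ≤ n) {c : Fin n → Fin n → ℕ}
    (hsym : ∀ i j, c i j = c j i) (h : ¬ HasPCPath n l c) :
    colorsUsed n c ≤ (l / 3 - 1) * n - (l / 3).choose 2 + 1 + l % 3 := by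
  rw [colorsUsed_eq hsym]
  simpa using card_colors_le (hsym := hsym) hl (by simpa using hn) (length_lt_of_not_hasPCPath h)

end Extremal

/-- For `l ≥ 27` and `n ≥ 2l³`,
`pr(K_n, P_l) = (⌊l/3⌋-1)n - C(⌊l/3⌋,2) + 1 + r_l` where `l ≡ r_l (mod 3)`. -/
theorem pr_path (l n : ℕ) (hl : 27 ≤ l) (hn : 2 * l ^ 3 ≤ n) :
    IsGreatest {m : ℕ | ∃ c : Fin n → Fin n → ℕ, (∀ i j, c i j = c j i) ∧
      ¬ HasPCPath n l c ∧ colorsUsed n c = m}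
      ((l / 3 - 1) * n - Nat.choose (l / 3) 2 + 1 + l % 3) := by
  have hln : l ≤ n := by
    have := Nat.le_self_pow (n := 3) (by omega) l
    omega
  refine ⟨⟨fun i j => extremalColor (l / 3 - 1) (l % 3) i j,
    fun i j => extremalColor_comm _ _ _ _, not_hasPCPath_extremalColor (by omega),
    le_antisymm (colorsUsed_le hl hn (fun i j => extremalColor_comm _ _ _ _)
      (not_hasPCPath_extremalColor (by omega))) ?_⟩, ?_⟩
  · have h := le_colorsUsed_extremalColor (n := n) (a := l / 3 - 1) (r := l % 3) (by omega)
    rwa [Nat.sub_add_cancel (by omega : 1 ≤ l / 3)] at h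
  · rintro m ⟨c, hsym, hno, rfl⟩
    exact colorsUsed_le hl hn hsym hno
end

section
/- For every n ≥ 6, the maximum number of colors in an edge-coloring of K_n with no properly colored 6-cycle equals n + 5. -/
/-- The edge-colored `K_n` contains a properly colored cycle on `k` vertices. -/
def HasPCCycle (n k : ℕ) (c : Fin n → Fin n → ℕ) : Prop :=
  ∃ p : Fin k → Fin n, Function.Injective p ∧
    ∀ i : Fin k,
      c (p i) (p ⟨(i.1 + 1) % k, Nat.mod_lt _ (Nat.lt_of_le_of_lt (Nat.zero_le _) i.isLt)⟩) ≠
        c (p ⟨(i.1 + 1) % k, Nat.mod_lt _ (Nat.lt_of_le_of_lt (Nat.zero_le _) i.isLt)⟩)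
          (p ⟨(i.1 + 2) % k, Nat.mod_lt _ (Nat.lt_of_le_of_lt (Nat.zero_le _) i.isLt)⟩)

section SaturatedArcs

variable {V : Type*} {k : V → V → ℕ} {A : V → V → Prop}

/-- The arcs `A` behave like the saturated edges of a coloring `k` without a properly colored
six-cycle: the color of an arc appears only on edges at its source, and every vertex is the source
of arcs of at least two colors. -/
structure Saturated (k : V → V → ℕ) (A : V → V → Prop) : Prop where
  symm : ∀ u v, k u v = k v u
  ne : ∀ {u v}, A u v → u ≠ v
  local_ne : ∀ {u v w}, A u v → w ≠ u → w ≠ v → k v w ≠ k u v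
  congr : ∀ {u v w}, A u v → w ≠ u → k u w = k u v → A u w
  two : ∀ v, ∃ u w, A v u ∧ A v w ∧ k v u ≠ k v w
  noPC : ∀ a b c d e f, [a, b, c, d, e, f].Nodup →
    k a b = k b c ∨ k b c = k c d ∨ k c d = k d e ∨ k d e = k e f ∨ k e f = k f a ∨ k f a = k a b

/-- The listed six vertices are distinct and are all the vertices. -/
structure Spans (a b c d e f : V) : Prop where
  nodup : [a, b, c, d, e, f].Nodup
  cases : ∀ v, v = a ∨ v = b ∨ v = c ∨ v = d ∨ v = e ∨ v = f

theorem Spans.rotate_three {a b c x y z : V} (hs : Spans a b c x y z) : Spans b c a x y z :=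
  ⟨by grind [hs.nodup], fun v ↦ by grind [hs.cases v]⟩

theorem Spans.rotate_four {a b c d x y : V} (hs : Spans a b c d x y) : Spans b c d a x y :=
  ⟨by grind [hs.nodup], fun v ↦ by grind [hs.cases v]⟩

theorem Spans.swap_last {a b c d x y : V} (hs : Spans a b c d x y) : Spans a b c d y x :=
  ⟨by grind [hs.nodup], fun v ↦ by grind [hs.cases v]⟩

theorem Spans.swap_middle {a b c x y z : V} (hs : Spans a b c x y z) : Spans a b c y x z :=
  ⟨by grind [hs.nodup], fun v ↦ by grind [hs.cases v]⟩

theorem fork_one_four (h : Saturated k A) {y x a b c d : V} (hd : [y, x, a, b, c, d].Nodup)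
    (hx : A y x) (ha : A y a) (hab : A a b) (hbc : A b c) (hcd : A c d) : k y x = k y a := by
  have := h.noPC y a b c d x (by grind)
  have := h.symm
  have := @h.local_ne
  simp only [List.nodup_cons, List.mem_cons, List.not_mem_nil] at hd
  grind

theorem fork_two_three (h : Saturated k A) {y x w a b c : V} (hd : [y, x, w, a, b, c].Nodup)
    (hx : A y x) (hw : A x w) (ha : A y a) (hab : A a b) (hbc : A b c) : k y x = k y a := by
  have := h.noPC y a b c w x (by grind)
  have := h.symm
  have := @h.local_ne
  simp only [List.nodup_cons, List.mem_cons, List.not_mem_nil] at hd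
  grind

theorem closing_edge (h : Saturated k A) {a b c d e f : V} (hd : [a, b, c, d, e, f].Nodup)
    (hab : A a b) (hbc : A b c) (hcd : A c d) (hde : A d e) (hef : A e f) : k a f = k a b := by
  have := h.noPC a b c d e f hd
  have := h.symm
  have := @h.local_ne
  simp only [List.nodup_cons, List.mem_cons, List.not_mem_nil] at hd
  grind

theorem not_cycle_six (h : Saturated k A) {a b c d e f : V} (hd : [a, b, c, d, e, f].Nodup)
    (hab : A a b) (hbc : A b c) (hcd : A c d) (hde : A d e) (hef : A e f) (hfa : A f a) : False := by
  have := closing_edge h hd hab hbc hcd hde hef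
  have := h.symm
  have := @h.local_ne
  simp only [List.nodup_cons, List.mem_cons, List.not_mem_nil] at hd
  grind

theorem not_cycle_five (h : Saturated k A) {a b c d e f : V} (hs : Spans a b c d e f)
    (hab : A a b) (hbc : A b c) (hcd : A c d) (hde : A d e) (hea : A e a) : False := by
  obtain ⟨u, w, hu, hw, hne⟩ := h.two f
  have h1 : A f a → k f e = k f a := fun hf ↦
    closing_edge h (by grind [hs.nodup]) hf hab hbc hcd hde
  have h2 : A f b → k f a = k f b := fun hf ↦
    closing_edge h (by grind [hs.nodup]) hf hbc hcd hde hea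
  have h3 : A f c → k f b = k f c := fun hf ↦
    closing_edge h (by grind [hs.nodup]) hf hcd hde hea hab
  have h4 : A f d → k f c = k f d := fun hf ↦
    closing_edge h (by grind [hs.nodup]) hf hde hea hab hbc
  have h5 : A f e → k f d = k f e := fun hf ↦
    closing_edge h (by grind [hs.nodup]) hf hea hab hbc hcd
  have := @h.congr
  have := @h.ne
  have := hs.cases u
  have := hs.cases w
  have hd := hs.nodup
  simp only [List.nodup_cons, List.mem_cons, List.not_mem_nil] at hd
  grind

theorem exists_target_color_ne (h : Saturated k A) (v : V) (m : ℕ) : ∃ u, A v u ∧ k v u ≠ m := by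
  obtain ⟨u, w, hu, hw, hne⟩ := h.two v
  grind

theorem exists_target_ne (h : Saturated k A) (v w : V) : ∃ u, A v u ∧ u ≠ w := by
  obtain ⟨u, hu, hne⟩ := exists_target_color_ne h v (k v w)
  grind

theorem not_cycle_four_and_arc (h : Saturated k A) {a b c d x y : V} (hs : Spans a b c d x y)
    (hab : A a b) (hbc : A b c) (hcd : A c d) (hda : A d a) : ¬ A y x := by
  intro hyx
  obtain ⟨u, hu, hne⟩ := exists_target_color_ne h y (k y x)
  have h1 : A y a → k y x = k y a := fun hy ↦
    fork_one_four h (by grind [hs.nodup]) hyx hy hab hbc hcd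
  have h2 : A y b → k y x = k y b := fun hy ↦
    fork_one_four h (by grind [hs.nodup]) hyx hy hbc hcd hda
  have h3 : A y c → k y x = k y c := fun hy ↦
    fork_one_four h (by grind [hs.nodup]) hyx hy hcd hda hab
  have h4 : A y d → k y x = k y d := fun hy ↦
    fork_one_four h (by grind [hs.nodup]) hyx hy hda hab hbc
  have := h.ne hu
  have := hs.cases u
  grind

theorem closing_two (h : Saturated k A) {a b c d x y : V} (hd : [a, b, c, d, x, y].Nodup)
    (hab : A a b) (hbc : A b c) (hcd : A c d) (hxy : ¬ A x y) (hyx : ¬ A y x) (hx : A x a) :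
    ¬ A y d := by
  have := h.noPC x a b c d y (by grind)
  have := h.symm
  have := @h.local_ne
  have := @h.congr
  simp only [List.nodup_cons, List.mem_cons, List.not_mem_nil] at hd
  grind

theorem not_cycle_four_of_alternating (h : Saturated k A) {a b c d x y : V}
    (hd : [a, b, c, d, x, y].Nodup) (hab : A a b) (hcd : A c d)
    (hxd : ¬ A x d) (hyb : ¬ A y b) (hxa : A x a) (hyc : A y c) : False := by
  have := h.noPC x a b y c d (by grind)
  have := h.symm
  have := @h.local_ne
  have := @h.congr
  simp only [List.nodup_cons, List.mem_cons, List.not_mem_nil] at hd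
  grind

theorem not_cycle_four (h : Saturated k A) {a b c d x y : V} (hs : Spans a b c d x y)
    (hab : A a b) (hbc : A b c) (hcd : A c d) (hda : A d a) : False := by
  have hyx : ¬ A y x := not_cycle_four_and_arc h hs hab hbc hcd hda
  have hxy : ¬ A x y := not_cycle_four_and_arc h hs.swap_last hab hbc hcd hda
  have x1 := closing_two h (hs.1) hab hbc hcd hxy hyx
  have x2 := closing_two h (hs.rotate_four).1 hbc hcd hda hxy hyx
  have x3 := closing_two h (hs.rotate_four.rotate_four).1 hcd hda hab hxy hyx
  have x4 := closing_two h (hs.rotate_four.rotate_four.rotate_four).1 hda hab hbc hxy hyx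
  have y1 := closing_two h (hs.swap_last).1 hab hbc hcd hyx hxy
  have y2 := closing_two h (hs.swap_last.rotate_four).1 hbc hcd hda hyx hxy
  have y3 := closing_two h (hs.swap_last.rotate_four.rotate_four).1 hcd hda hab hyx hxy
  have y4 := closing_two h (hs.swap_last.rotate_four.rotate_four.rotate_four).1 hda hab hbc hyx hxy
  obtain ⟨u, w, hu, hw, hne⟩ := h.two x
  obtain ⟨u', w', hu', hw', hne'⟩ := h.two y
  have := h.ne hu
  have := h.ne hw
  have := h.ne hu'
  have := h.ne hw'
  have mu := hs.cases u
  have mw := hs.cases w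
  have mu' := hs.cases u'
  have mw' := hs.cases w'
  have : A x a ∧ A x c ∧ k x a ≠ k x c ∧ A y a ∧ A y c ∧ k y a ≠ k y c ∨
      A x b ∧ A x d ∧ k x b ≠ k x d ∧ A y b ∧ A y d ∧ k y b ≠ k y d := by
    grind (splits := 30)
  rcases this with ⟨hxa, -, -, hya, hyc, -⟩ | ⟨hxb, -, -, hyb, hyd, -⟩
  · exact not_cycle_four_of_alternating h hs.1 hab hcd (y1 hya) (fun hyb ↦ y2 hyb hxa) hxa hyc
  · exact not_cycle_four_of_alternating h hs.rotate_four.1 hbc hda (y2 hyb)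
      (fun hyc ↦ y3 hyc hxb) hxb hyd

theorem outside_path_completes (h : Saturated k A) {a b c x y z : V} (hs : Spans a b c x y z)
    (hab : A a b) (hbc : A b c) (hca : A c a) (hxy : A x y) (hyz : A y z) :
    A x z ∧ A z x ∧ A z y ∧ k z x ≠ k z y := by
  have hd := hs.nodup
  have f1 : A x a → k x y = k x a := fun hx ↦ fork_two_three h (by grind) hxy hyz hx hab hbc
  have f2 : A x b → k x y = k x b := fun hx ↦ fork_two_three h (by grind) hxy hyz hx hbc hca
  have f3 : A x c → k x y = k x c := fun hx ↦ fork_two_three h (by grind) hxy hyz hx hca hab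
  obtain ⟨u, hu, hne⟩ := exists_target_color_ne h x (k x y)
  have hxz : A x z ∧ k x z ≠ k x y := by
    have := hs.cases u
    have := h.ne hu
    grind
  have g1 : A z a → k x y = k x z := fun hz ↦ fork_one_four h (by grind) hxy hxz.1 hz hab hbc
  have g2 : A z b → k x y = k x z := fun hz ↦ fork_one_four h (by grind) hxy hxz.1 hz hbc hca
  have g3 : A z c → k x y = k x z := fun hz ↦ fork_one_four h (by grind) hxy hxz.1 hz hca hab
  obtain ⟨v, w, hv, hw, hvw⟩ := h.two z
  have := hs.cases v
  have := hs.cases w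
  have := h.ne hv
  have := h.ne hw
  grind (splits := 30)

theorem color_eq_of_link (h : Saturated k A) {a b c x y z : V} (hd : [a, b, c, x, y, z].Nodup)
    (hab : A a b) (hbc : A b c) (hyx : A y x) (hyz : A y z) (hne : k y x ≠ k y z) :
    k a z = k a b := by
  have := h.noPC a b c x y z hd
  have := h.symm
  have := @h.local_ne
  simp only [List.nodup_cons, List.mem_cons, List.not_mem_nil] at hd
  grind

theorem no_outside_path (h : Saturated k A) {a b c x y z : V} (hs : Spans a b c x y z)
    (hab : A a b) (hbc : A b c) (hca : A c a) (hxy : A x y) : ¬ A y z := by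
  intro hyz
  obtain ⟨hxz, hzx, hzy, hz⟩ := outside_path_completes h hs hab hbc hca hxy hyz
  obtain ⟨-, hyx, -, hy⟩ := outside_path_completes h hs.swap_last hab hbc hca hxz hzy
  obtain ⟨-, -, -, hx⟩ :=
    outside_path_completes h hs.swap_last.swap_middle.swap_last hab hbc hca hzy hyx
  have hd := hs.nodup
  have other : ∀ a b c, Spans a b c x y z → A a b → A b c → A a c ∧ k a c ≠ k a b := by
    intro a b c hs hab hbc
    have hd := hs.nodup
    have e1 : k a z = k a b := color_eq_of_link h hd hab hbc hyx hyz hy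
    have e2 : k a y = k a b := color_eq_of_link h (x := x) (y := z) (by grind) hab hbc hzx hzy hz
    have e3 : k a x = k a b :=
      color_eq_of_link h (x := z) (y := y) (by grind) hab hbc hyz hyx hy.symm
    obtain ⟨u, hu, hne⟩ := exists_target_color_ne h a (k a b)
    have := hs.cases u
    have := h.ne hu
    grind
  have ha := other a b c hs hab hbc
  have hc := other c a b hs.rotate_three.rotate_three hca hab
  have e1 : k a z = k a b := color_eq_of_link h hd hab hbc hyx hyz hy
  have e2 : k a z = k a c := color_eq_of_link h (by grind) ha.1 hc.1 hyx hyz hy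
  grind

theorem no_fork_to_inside_and_outside (h : Saturated k A) {a b c x y z : V}
    (hs : Spans a b c x y z) (hab : A a b) (hbc : A b c) (hca : A c a) (hyx : A y x)
    (hya : A y a) : k y a = k y x := by
  by_contra hne
  have nxz : ¬ A x z := no_outside_path h hs.swap_middle hab hbc hca hyx
  have nzy : ¬ A z y := fun hzy ↦
    no_outside_path h hs.swap_last.swap_middle.swap_last hab hbc hca hzy hyx
  have nxy : A z x → ¬ A x y := fun hzx ↦
    no_outside_path h hs.swap_last.swap_middle hab hbc hca hzx
  have nyz : A z x → ¬ A y z := fun hzx hyz ↦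
    no_outside_path h hs.swap_middle.swap_last hab hbc hca hyz hzx
  have hd := hs.nodup
  have hcz : k c z = k z x := by
    have := h.noPC y a b c z x (by grind)
    have := h.symm
    have := @h.local_ne
    simp only [List.nodup_cons, List.mem_cons, List.not_mem_nil] at hd
    grind
  by_cases hzx : A z x
  · have hza : A z a ∧ k z a ≠ k z x := by
      obtain ⟨u, hu, hune⟩ := exists_target_color_ne h z (k z x)
      have := h.noPC z b c a y x (by grind)
      have := h.symm
      have := @h.local_ne
      have := hs.cases u
      have := h.ne hu
      simp only [List.nodup_cons, List.mem_cons, List.not_mem_nil] at hd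
      grind
    have hcy : k c y = k y x := by
      have := h.noPC z a b c y x (by grind)
      have := h.symm
      have := @h.local_ne
      simp only [List.nodup_cons, List.mem_cons, List.not_mem_nil] at hd
      grind
    have hyc : A y c := h.congr hyx (by grind) (by rw [h.symm, hcy])
    have hzc : A z c := h.congr hzx (by grind) (by rw [h.symm, hcz])
    have nxb : ¬ A x b := by
      intro hxb
      have := h.noPC x b c y a z (by grind)
      have := h.symm
      have := @h.local_ne
      simp only [List.nodup_cons, List.mem_cons, List.not_mem_nil] at hd
      grind
    have hx : A x a ∧ A x c ∧ k x a ≠ k x c := by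
      obtain ⟨v, w, hv, hw, hvw⟩ := h.two x
      have := hs.cases v
      have := hs.cases w
      have := h.ne hv
      have := h.ne hw
      grind
    have := h.noPC x c y a b z (by grind)
    have := h.noPC x c z a b y (by grind)
    have := h.noPC x a b y z c (by grind)
    have := h.symm
    have := @h.local_ne
    have := @h.congr
    simp only [List.nodup_cons, List.mem_cons, List.not_mem_nil] at hd
    grind
  · have hzb : A z b := by
      have hxz : x ≠ z := by rintro rfl; simp at hd
      have : ¬ A z c := fun hzc ↦ hzx (h.congr hzc hxz (by rw [← hcz, h.symm]))
      obtain ⟨v, w, hv, hw, hvw⟩ := h.two z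
      have := hs.cases v
      have := hs.cases w
      have := h.ne hv
      have := h.ne hw
      grind
    have := h.noPC z b c a y x (by grind)
    have := h.symm
    have := @h.local_ne
    have := @h.congr
    simp only [List.nodup_cons, List.mem_cons, List.not_mem_nil] at hd
    grind

theorem no_outside_arc (h : Saturated k A) {a b c x y z : V} (hs : Spans a b c x y z)
    (hab : A a b) (hbc : A b c) (hca : A c a) : ¬ A y x := by
  intro hyx
  have hd := hs.nodup
  have nxz : ¬ A x z := no_outside_path h hs.swap_middle hab hbc hca hyx
  have f1 := no_fork_to_inside_and_outside h hs hab hbc hca hyx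
  have f2 := no_fork_to_inside_and_outside h hs.rotate_three hbc hca hab hyx
  have f3 := no_fork_to_inside_and_outside h hs.rotate_three.rotate_three hca hab hbc hyx
  have hyz : A y z ∧ k y z ≠ k y x := by
    obtain ⟨u, hu, hne⟩ := exists_target_color_ne h y (k y x)
    have := hs.cases u
    have := h.ne hu
    grind
  obtain ⟨u, hu, hne⟩ := exists_target_ne h x y
  have g1 : A x a → k y z = k y x := fun hx ↦
    fork_one_four h (by grind) hyz.1 hyx hx hab hbc
  have g2 : A x b → k y z = k y x := fun hx ↦
    fork_one_four h (by grind) hyz.1 hyx hx hbc hca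
  have g3 : A x c → k y z = k y x := fun hx ↦
    fork_one_four h (by grind) hyz.1 hyx hx hca hab
  have := hs.cases u
  have := h.ne hu
  grind

theorem arc_of_no_outside_arc (h : Saturated k A) {a b c x y z : V}
    (hd : [a, b, c, x, y, z].Nodup) (hbc : A b c) (hxy : ¬ A x y) (hyx : ¬ A y x)
    (hxb : A x b) (hya : A y a) (hza : A z a) : A z c ∧ k z c = k z a := by
  have := h.noPC x b c z a y (by grind)
  have := h.symm
  have := @h.local_ne
  have := @h.congr
  simp only [List.nodup_cons, List.mem_cons, List.not_mem_nil] at hd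
  grind

theorem not_cycle_three (h : Saturated k A) {a b c x y z : V} (hs : Spans a b c x y z)
    (hab : A a b) (hbc : A b c) (hca : A c a) : False := by
  have hxy := no_outside_arc h hs.swap_middle hab hbc hca
  have hyx := no_outside_arc h hs hab hbc hca
  have hxz := no_outside_arc h hs.swap_last.swap_middle hab hbc hca
  have hzx := no_outside_arc h hs.swap_last hab hbc hca
  have hyz := no_outside_arc h hs.swap_middle.swap_last.swap_middle hab hbc hca
  have hzy := no_outside_arc h hs.swap_middle.swap_last hab hbc hca
  have hnx := fun hx ↦ h.ne (u := x) (v := x) hx rfl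
  have hny := fun hx ↦ h.ne (u := y) (v := y) hx rfl
  have hnz := fun hx ↦ h.ne (u := z) (v := z) hx rfl
  have aligned : ∀ x y z, Spans a b c x y z → ¬ A x y → ¬ A y x →
      (A x b → A y a → A z a → A z c ∧ k z c = k z a) ∧
      (A x c → A y b → A z b → A z a ∧ k z a = k z b) ∧
      (A x a → A y c → A z c → A z b ∧ k z b = k z c) := by
    intro x y z hs hxy hyx
    exact ⟨arc_of_no_outside_arc h hs.1 hbc hxy hyx,
      arc_of_no_outside_arc h hs.rotate_three.1 hca hxy hyx,
      arc_of_no_outside_arc h hs.rotate_three.rotate_three.1 hab hxy hyx⟩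
  have e1 := aligned x y z hs hxy hyx
  have e2 := aligned y x z hs.swap_middle hyx hxy
  have e3 := aligned x z y hs.swap_last hxz hzx
  have e4 := aligned z x y hs.swap_last.swap_middle hzx hxz
  have e5 := aligned y z x hs.swap_middle.swap_last hyz hzy
  have e6 := aligned z y x hs.swap_middle.swap_last.swap_middle hzy hyz
  clear aligned
  obtain ⟨u₁, v₁, hu₁, hv₁, h₁⟩ := h.two x
  obtain ⟨u₂, v₂, hu₂, hv₂, h₂⟩ := h.two y
  obtain ⟨u₃, v₃, hu₃, hv₃, h₃⟩ := h.two z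
  have := hs.cases u₁
  have := hs.cases v₁
  have := hs.cases u₂
  have := hs.cases v₂
  have := hs.cases u₃
  have := hs.cases v₃
  grind (splits := 50)

theorem exists_spans_of_three [Fintype V] (hV : Fintype.card V = 6) {a b c : V}
    (hd : [a, b, c].Nodup) : ∃ x y z, Spans a b c x y z := by
  classical
  have h3 : (({a, b, c} : Finset V)ᶜ).card = 3 := by
    rw [Finset.card_compl, hV, Finset.card_eq_three.2 ⟨a, b, c, by grind⟩]
  obtain ⟨x, y, z, hxy, hxz, hyz, hs⟩ := Finset.card_eq_three.1 h3
  have hmem : ∀ v, v ∉ ({a, b, c} : Finset V) ↔ v ∈ ({x, y, z} : Finset V) := fun v ↦ by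
    rw [← hs, Finset.mem_compl]
  simp only [Finset.mem_insert, Finset.mem_singleton] at hmem
  exact ⟨x, y, z, by grind [hmem x, hmem y, hmem z], fun v ↦ by grind [hmem v]⟩

theorem Spans.exists_of_four {a b c x y z d : V} (hs : Spans a b c x y z)
    (hd : [a, b, c, d].Nodup) : ∃ x y, Spans a b c d x y := by
  have h : d = x ∨ d = y ∨ d = z := by grind [hs.cases d]
  rcases h with rfl | rfl | rfl
  · exact ⟨y, z, hs⟩
  · exact ⟨x, z, hs.swap_middle⟩
  · exact ⟨x, y, hs.swap_last.swap_middle⟩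

theorem Spans.exists_of_five {a b c d x y e : V} (hs : Spans a b c d x y)
    (hd : [a, b, c, d, e].Nodup) : ∃ x, Spans a b c d e x := by
  have h : e = x ∨ e = y := by grind [hs.cases e]
  rcases h with rfl | rfl
  · exact ⟨y, hs⟩
  · exact ⟨x, hs.swap_last⟩

theorem not_saturated_of_card_eq_six [Fintype V] (hV : Fintype.card V = 6) :
    ¬ Saturated k A := by
  intro h
  have no3 : ∀ a b c : V, A a b → A b c → A c a → a ≠ c → False := by
    intro a b c hab hbc hca hac
    obtain ⟨x, y, z, hs⟩ := exists_spans_of_three hV (a := a) (b := b) (c := c)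
      (by grind [h.ne hab, h.ne hbc])
    exact not_cycle_three h hs hab hbc hca
  have : Nonempty V := Fintype.card_pos_iff.1 (by lia)
  obtain ⟨a⟩ := this
  obtain ⟨b, hab, -⟩ := exists_target_ne h a a
  obtain ⟨c, hbc, hca⟩ := exists_target_ne h b a
  obtain ⟨x, y, z, hs₃⟩ := exists_spans_of_three hV (a := a) (b := b) (c := c)
    (by grind [h.ne hab, h.ne hbc])
  obtain ⟨d, hcd, hdb⟩ := exists_target_ne h c b
  have hda : d ≠ a := by rintro rfl; exact no3 _ _ _ hab hbc hcd hca.symm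
  obtain ⟨x, y, hs₄⟩ := hs₃.exists_of_four (d := d) (by grind [hs₃.nodup, h.ne hcd])
  obtain ⟨e, hde, hec⟩ := exists_target_ne h d c
  have heb : e ≠ b := by rintro rfl; exact no3 _ _ _ hbc hcd hde hdb.symm
  have hea : e ≠ a := by rintro rfl; exact not_cycle_four h hs₄ hab hbc hcd hde
  obtain ⟨f, hs₅⟩ := hs₄.exists_of_five (e := e) (by grind [hs₄.nodup, h.ne hde])
  obtain ⟨g, heg, hgd⟩ := exists_target_ne h e d
  have hgc : g ≠ c := by rintro rfl; exact no3 _ _ _ hcd hde heg hec.symm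
  have hgb : g ≠ b := by
    rintro rfl
    obtain ⟨x, y, z, hs⟩ := exists_spans_of_three hV (a := g) (b := c) (c := d)
      (by grind [hs₄.nodup])
    obtain ⟨x, y, hs⟩ := hs.exists_of_four (d := e) (by grind [hs₅.nodup])
    exact not_cycle_four h hs hbc hcd hde heg
  have hga : g ≠ a := by rintro rfl; exact not_cycle_five h hs₅ hab hbc hcd hde heg
  obtain rfl : g = f := by grind [hs₅.cases g, h.ne heg]
  have hd := hs₅.nodup
  obtain ⟨u, hgu, hue⟩ := exists_target_ne h g e
  rcases hs₅.cases u with rfl | rfl | rfl | rfl | rfl | rfl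
  · exact not_cycle_six h hd hab hbc hcd hde heg hgu
  · obtain ⟨x, y, z, hs⟩ := exists_spans_of_three hV (a := u) (b := c) (c := d) (by grind)
    obtain ⟨x, y, hs⟩ := hs.exists_of_four (d := e) (by grind)
    obtain ⟨x, hs⟩ := hs.exists_of_five (e := g) (by grind)
    exact not_cycle_five h hs hbc hcd hde heg hgu
  · obtain ⟨x, y, z, hs⟩ := exists_spans_of_three hV (a := u) (b := d) (c := e) (by grind)
    obtain ⟨x, y, hs⟩ := hs.exists_of_four (d := g) (by grind)
    exact not_cycle_four h hs hcd hde heg hgu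
  · exact no3 _ _ _ hde heg hgu (by grind)
  · exact hue rfl
  · exact h.ne hgu rfl

/-- The edge `v u` lies inside `S`, and every edge of `S` with its color is incident to `v`. -/
def SaturatedArc (k : V → V → ℕ) (S : Finset V) (v u : V) : Prop :=
  v ∈ S ∧ u ∈ S ∧ v ≠ u ∧ ∀ x ∈ S, ∀ y ∈ S, x ≠ y → x ≠ v → y ≠ v → k x y ≠ k v u

/-- Every vertex of `S` is the source of saturated arcs of at least two colors. -/
def DoublySaturated (k : V → V → ℕ) (S : Finset V) : Prop :=
  ∀ v ∈ S, ∃ u w, SaturatedArc k S v u ∧ SaturatedArc k S v w ∧ k v u ≠ k v w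

/-- The coloring `k` has no properly colored six-cycle. -/
def AvoidsSixCycle (k : V → V → ℕ) : Prop :=
  ∀ a b c d e f, [a, b, c, d, e, f].Nodup →
    k a b = k b c ∨ k b c = k c d ∨ k c d = k d e ∨ k d e = k e f ∨ k e f = k f a ∨ k f a = k a b

theorem AvoidsSixCycle.not_doublySaturated_of_card_eq_six (hk : AvoidsSixCycle k)
    (symm : ∀ u v, k u v = k v u) {S : Finset V} (hS : S.card = 6) : ¬ DoublySaturated k S := by
  intro h2
  refine not_saturated_of_card_eq_six (V := S) (k := fun u v ↦ k u v)
    (A := fun u v ↦ SaturatedArc k S u v) (by simpa using hS) ?_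
  constructor
  · exact fun u v ↦ symm u v
  · intro u v h huv
    exact h.2.2.1 (congrArg Subtype.val huv)
  · intro u v w h hwu hwv
    exact h.2.2.2 v v.2 w w.2 (fun e ↦ hwv (Subtype.ext e.symm))
      (fun e ↦ h.2.2.1 e.symm) (fun e ↦ hwu (Subtype.ext e))
  · intro u v w h hwu he
    refine ⟨u.2, w.2, fun e ↦ hwu (Subtype.ext e.symm), fun x hx y hy hxy hxu hyu ↦ ?_⟩
    exact fun e ↦ h.2.2.2 x hx y hy hxy hxu hyu (e.trans he)
  · rintro ⟨v, hv⟩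
    obtain ⟨u, w, hu, hw, hne⟩ := h2 v hv
    exact ⟨⟨u, hu.2.1⟩, ⟨w, hw.2.1⟩, hu, hw, hne⟩
  · intro a b c d e f hd
    refine hk a b c d e f ?_
    simpa using hd.map Subtype.val_injective

theorem exists_few_conflicts [DecidableEq V] {R : Finset V} (hR : R.Nonempty) (f : V → V)
    (hf : ∀ u, (R.filter fun w ↦ f w = u).card ≤ 2) :
    ∃ v ∈ R, (R.filter fun w ↦ w = v ∨ w = f v ∨ f w = v ∨ f w = f v).card ≤ 3 := by
  by_cases hsub : R ⊆ R.image f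
  · have himg : R.image f = R :=
      (Finset.eq_of_subset_of_card_le hsub Finset.card_image_le).symm
    have hinj : Set.InjOn f R := Finset.card_image_iff.1 (congrArg Finset.card himg)
    obtain ⟨v, hv⟩ := hR
    obtain ⟨w, hw, hwv⟩ := Finset.mem_image.1 (hsub hv)
    refine ⟨v, hv, (Finset.card_le_card fun x hx ↦ ?_).trans
      (Finset.card_le_three (a := v) (b := f v) (c := w))⟩
    have h1 := @hinj x
    simp only [Finset.mem_filter, Finset.mem_coe, Finset.mem_insert, Finset.mem_singleton] at *
    grind
  · obtain ⟨v, hv, hvf⟩ := Finset.not_subset.1 hsub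
    refine ⟨v, hv, ?_⟩
    calc _ ≤ (insert (f v) (R.filter fun w ↦ f w = f v)).card := by
          refine Finset.card_le_card fun x hx ↦ ?_
          simp only [Finset.mem_filter, Finset.mem_insert, Finset.mem_image, not_exists,
            not_and] at *
          grind
      _ ≤ 3 := (Finset.card_insert_le _ _).trans (Nat.succ_le_succ (hf _))

theorem exists_three_independent [DecidableEq V] {S : Finset V} (hS : 7 ≤ S.card) (f : V → V)
    (hf : ∀ u, (S.filter fun w ↦ f w = u).card ≤ 2) (hne : ∀ v ∈ S, f v ≠ v) :
    ∃ a ∈ S, ∃ b ∈ S, ∃ c ∈ S, [a, f a, b, f b, c, f c].Nodup := by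
  have hsub : ∀ R ⊆ S, ∀ u, (R.filter fun w ↦ f w = u).card ≤ 2 := fun R hR u ↦
    (Finset.card_le_card (Finset.filter_subset_filter _ hR)).trans (hf u)
  obtain ⟨a, ha, hac⟩ := exists_few_conflicts (Finset.card_pos.1 (by lia)) f hf
  obtain ⟨R, hR⟩ : ∃ R, R = S.filter fun w ↦ ¬(w = a ∨ w = f a ∨ f w = a ∨ f w = f a) := ⟨_, rfl⟩
  have hRS : R ⊆ S := hR ▸ Finset.filter_subset _ _
  have hRc : 4 ≤ R.card := by
    have := Finset.card_filter_add_card_filter_not (s := S)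
      (fun w ↦ w = a ∨ w = f a ∨ f w = a ∨ f w = f a)
    rw [← hR] at this
    lia
  obtain ⟨b, hb, hbc⟩ := exists_few_conflicts (Finset.card_pos.1 (by lia)) f (hsub R hRS)
  obtain ⟨c, hc⟩ : (R.filter fun w ↦ ¬(w = b ∨ w = f b ∨ f w = b ∨ f w = f b)).Nonempty := by
    have := Finset.card_filter_add_card_filter_not (s := R)
      (fun w ↦ w = b ∨ w = f b ∨ f w = b ∨ f w = f b)
    exact Finset.card_pos.1 (by lia)
  have hcR := (Finset.mem_filter.1 hc).1
  refine ⟨a, ha, b, hRS hb, c, hRS hcR, ?_⟩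
  have := hne a ha
  have := hne b (hRS hb)
  have := hne c (hRS hcR)
  have := (Finset.mem_filter.1 hc).2
  rw [hR] at hb hcR
  have := (Finset.mem_filter.1 hb).2
  have := (Finset.mem_filter.1 hcR).2
  simp only [List.nodup_cons, List.mem_cons, List.not_mem_nil, List.nodup_nil]
  grind

theorem SaturatedArc.erase [DecidableEq V] {S : Finset V} {v u w : V} (h : SaturatedArc k S v u)
    (hv : v ≠ w) (hu : u ≠ w) : SaturatedArc k (S.erase w) v u :=
  ⟨Finset.mem_erase.2 ⟨hv, h.1⟩, Finset.mem_erase.2 ⟨hu, h.2.1⟩, h.2.2.1, fun x hx y hy ↦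
    h.2.2.2 x (Finset.mem_of_mem_erase hx) y (Finset.mem_of_mem_erase hy)⟩

theorem AvoidsSixCycle.exists_doublySaturated_erase [DecidableEq V] (hk : AvoidsSixCycle k)
    (symm : ∀ u v, k u v = k v u) {S : Finset V} (hS : 7 ≤ S.card) (h2 : DoublySaturated k S) :
    ∃ v ∈ S, DoublySaturated k (S.erase v) := by
  by_contra! hno
  have hex : ∀ v : V, ∃ u, v ∈ S → u ≠ v ∧ SaturatedArc k S u v ∧
      (∀ x y, SaturatedArc k S u x → SaturatedArc k S u y → x ≠ v → y ≠ v → k u x = k u y) ∧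
      ∀ x, SaturatedArc k S u x → x ≠ v → k u x ≠ k u v := by
    intro v
    by_cases hv : v ∈ S
    swap
    · exact ⟨v, fun h ↦ absurd h hv⟩
    have := hno v hv
    simp only [DoublySaturated, not_forall] at this
    obtain ⟨u, hu, hlost⟩ := this
    obtain ⟨huv, huS⟩ := Finset.mem_erase.1 hu
    have heq : ∀ x y, SaturatedArc k S u x → SaturatedArc k S u y → x ≠ v → y ≠ v →
        k u x = k u y := by
      intro x y hx hy hxv hyv
      by_contra hxy
      exact hlost ⟨x, y, hx.erase huv hxv, hy.erase huv hyv, hxy⟩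
    obtain ⟨x, y, hx, hy, hxy⟩ := h2 u huS
    have hxyv : x = v ∨ y = v := by
      by_contra! h
      exact hxy (heq x y hx hy h.1 h.2)
    rcases hxyv with rfl | rfl
    · refine ⟨u, fun _ ↦ ⟨huv, hx, heq, fun z hz hzx ↦ ?_⟩⟩
      rw [heq z y hz hy hzx (by grind)]
      exact hxy.symm
    · refine ⟨u, fun _ ↦ ⟨huv, hy, heq, fun z hz hzy ↦ ?_⟩⟩
      rwa [heq z x hz hx hzy (by grind)]
  choose f hf using hex
  have solo : ∀ v ∈ S, ∀ x ∈ S, ∀ y ∈ S, x ≠ y → k x y = k (f v) v →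
      (x = f v ∧ y = v) ∨ (x = v ∧ y = f v) := by
    intro v hv x hx y hy hxy he
    obtain ⟨hne, harc, -, hdiff⟩ := hf v hv
    have hcongr : ∀ z ∈ S, f v ≠ z → k (f v) z = k (f v) v → z = v := by
      intro z hz hfz hzc
      by_contra hzv
      exact hdiff z ⟨harc.1, hz, hfz, by rw [hzc]; exact harc.2.2.2⟩ hzv hzc
    by_cases hxf : x = f v
    · subst hxf
      exact .inl ⟨rfl, hcongr y hy hxy he⟩
    by_cases hyf : y = f v
    · subst hyf
      exact .inr ⟨hcongr x hx hxy.symm (by rw [symm, he]), rfl⟩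
    exact absurd he (harc.2.2.2 x hx y hy hxy hxf hyf)
  have hfS : ∀ v ∈ S, f v ∈ S := fun v hv ↦ (hf v hv).2.1.1
  obtain ⟨a, ha, b, hb, c, hc, hd⟩ := exists_three_independent hS f (by
    intro u
    by_contra! hlt
    obtain ⟨a, ha, b, hb, c, hc, hab, hac, hbc⟩ := Finset.two_lt_card.1 hlt
    simp only [Finset.mem_filter] at ha hb hc
    obtain ⟨haS, rfl⟩ := ha
    have hfb := (hf b hb.1).2.1
    have hfc := (hf c hc.1).2.1
    rw [hb.2] at hfb
    rw [hc.2] at hfc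
    have h1 := (hf a haS).2.2.1 b c hfb hfc hab.symm hac.symm
    have h2 := solo b hb.1 (f a) hfc.1 c hc.1 hfc.2.2.1 (by rw [hb.2, h1])
    grind) (fun v hv ↦ (hf v hv).1)
  have := hk a (f a) b (f b) c (f c) hd
  have sa := solo a ha
  have sb := solo b hb
  have sc := solo c hc
  have := hfS a ha
  have := hfS b hb
  have := hfS c hc
  have s1 := sa (f a) ‹_› b hb
  have s2 := sb (f a) ‹_› b hb
  have s3 := sb (f b) ‹_› c hc
  have s4 := sc (f b) ‹_› c hc
  have s5 := sc (f c) ‹_› a ha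
  have s6 := sa (f c) ‹_› a ha
  have := symm a (f a)
  have := symm b (f b)
  have := symm c (f c)
  simp only [List.nodup_cons, List.mem_cons, List.not_mem_nil] at hd
  clear sa sb sc solo hfS hf hno h2 hk
  grind

theorem AvoidsSixCycle.not_doublySaturated [DecidableEq V] (hk : AvoidsSixCycle k)
    (symm : ∀ u v, k u v = k v u) {S : Finset V} (hS : 6 ≤ S.card) : ¬ DoublySaturated k S := by
  generalize hn : S.card = n at hS
  induction n, hS using Nat.le_induction generalizing S with
  | base => exact hk.not_doublySaturated_of_card_eq_six symm hn
  | succ n h6 ih =>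
    intro h2
    obtain ⟨v, hv, h⟩ := hk.exists_doublySaturated_erase symm (by lia) h2
    exact ih (by rw [Finset.card_erase_of_mem hv, hn]; rfl) h

/-- The colors of the edges inside `S`. -/
def edgeColors [DecidableEq V] (k : V → V → ℕ) (S : Finset V) : Finset ℕ :=
  S.offDiag.image fun p ↦ k p.1 p.2

theorem card_edgeColors_le_choose [DecidableEq V] (symm : ∀ u v, k u v = k v u) (S : Finset V) :
    (edgeColors k S).card ≤ S.card.choose 2 := by
  rw [← Sym2.card_image_offDiag]
  have : edgeColors k S = (S.offDiag.image Sym2.mk.uncurry).image (Sym2.lift ⟨k, symm⟩) := by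
    rw [Finset.image_image]
    rfl
  rw [this]
  exact Finset.card_image_le

theorem AvoidsSixCycle.card_edgeColors_le [DecidableEq V] (hk : AvoidsSixCycle k)
    (symm : ∀ u v, k u v = k v u) {S : Finset V} (hS : 5 ≤ S.card) :
    (edgeColors k S).card ≤ S.card + 5 := by
  generalize hn : S.card = n at hS ⊢
  induction n, hS using Nat.le_induction generalizing S with
  | base => simpa [hn, Nat.choose] using card_edgeColors_le_choose symm S
  | succ n h5 ih =>
    have h := hk.not_doublySaturated symm (S := S) (by lia)
    simp only [DoublySaturated, not_forall] at h
    obtain ⟨v, hv, hno⟩ := h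
    obtain ⟨m, hm⟩ : ∃ m, ∀ u, SaturatedArc k S v u → k v u = m := by
      by_cases hu : ∃ u, SaturatedArc k S v u
      · obtain ⟨u, hu⟩ := hu
        exact ⟨k v u, fun w hw ↦ by_contra fun hne ↦ hno ⟨w, u, hw, hu, hne⟩⟩
      · exact ⟨0, fun w hw ↦ absurd ⟨w, hw⟩ hu⟩
    have hstar : ∀ u ∈ S, v ≠ u → k v u ∈ insert m (edgeColors k (S.erase v)) := by
      intro u hu hvu
      by_contra hmem
      simp only [edgeColors, Finset.mem_insert, Finset.mem_image, Finset.mem_offDiag,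
        Finset.mem_erase, not_or, not_exists, not_and] at hmem
      exact hmem.1 (hm u ⟨hv, hu, hvu, fun x hx y hy hxy hxv hyv ↦
        hmem.2 (x, y) ⟨⟨hxv, hx⟩, ⟨hyv, hy⟩, hxy⟩⟩)
    have hsub : edgeColors k S ⊆ insert m (edgeColors k (S.erase v)) := by
      intro q hq
      obtain ⟨⟨x, y⟩, hxy, rfl⟩ := Finset.mem_image.1 hq
      obtain ⟨hx, hy, hne⟩ := Finset.mem_offDiag.1 hxy
      simp only at hx hy hne ⊢
      by_cases hxv : v = x
      · subst hxv
        exact hstar y hy hne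
      by_cases hyv : v = y
      · subst hyv
        rw [symm]
        exact hstar x hx hxv
      exact Finset.mem_insert_of_mem (Finset.mem_image.2 ⟨(x, y), by grind, rfl⟩)
    have := Finset.card_le_card hsub
    have := Finset.card_insert_le m (edgeColors k (S.erase v))
    have := ih (S := S.erase v) (by rw [Finset.card_erase_of_mem hv, hn]; rfl)
    lia

end SaturatedArcs

theorem colorsUsed_eq_card_edgeColors (n : ℕ) (c : Fin n → Fin n → ℕ) :
    colorsUsed n c = (edgeColors c Finset.univ).card := by
  have : (Finset.univ.filter fun p : Fin n × Fin n ↦ p.1 ≠ p.2) = Finset.univ.offDiag := by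
    ext p
    simp
  rw [colorsUsed, edgeColors, this]

theorem avoidsSixCycle_of_not_hasPCCycle {n : ℕ} {c : Fin n → Fin n → ℕ}
    (hc : ¬ HasPCCycle n 6 c) : AvoidsSixCycle c := by
  intro a b d e f g hd
  by_contra! h
  refine hc ⟨[a, b, d, e, f, g].get, List.nodup_iff_injective_get.1 hd, fun i ↦ ?_⟩
  fin_cases i
  exacts [h.1, h.2.1, h.2.2.1, h.2.2.2.1, h.2.2.2.2.1, h.2.2.2.2.2]

/-- A rainbow coloring on the first five vertices, where each later vertex gives a color of its own
to all its edges to earlier vertices. -/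
def extremalColoring (n : ℕ) (i j : Fin n) : ℕ :=
  if max i.1 j.1 < 5 then 5 * min i.1 j.1 + max i.1 j.1 else 20 + max i.1 j.1

theorem extremalColoring_comm (n : ℕ) (i j : Fin n) :
    extremalColoring n i j = extremalColoring n j i := by
  rw [extremalColoring, extremalColoring, max_comm, min_comm]

theorem extremalColoring_eq_left {n : ℕ} {i j : Fin n} (hj : j ≤ i) (hi : 5 ≤ i.1) :
    extremalColoring n i j = 20 + i.1 := by
  rw [extremalColoring, max_eq_left (Fin.le_def.1 hj), if_neg (by lia)]

theorem not_hasPCCycle_extremalColoring (n : ℕ) : ¬ HasPCCycle n 6 (extremalColoring n) := by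
  rintro ⟨p, hp, hne⟩
  obtain ⟨m, -, hm⟩ := Finset.exists_max_image Finset.univ p Finset.univ_nonempty
  replace hm : ∀ i, p i ≤ p m := fun i ↦ hm i (Finset.mem_univ i)
  have hm5 : 5 ≤ (p m).1 := by
    by_contra! hlt
    have := Fintype.card_le_of_injective
      (fun i ↦ (⟨(p i).1, (Fin.le_def.1 (hm i)).trans_lt hlt⟩ : Fin 5))
      (fun i j hij ↦ hp (by simpa [Fin.ext_iff] using hij))
    simp at this
  have h := hne ⟨(m.1 + 5) % 6, Nat.mod_lt _ (by lia)⟩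
  have hm' : (⟨((m.1 + 5) % 6 + 1) % 6, Nat.mod_lt _ (by lia)⟩ : Fin 6) = m :=
    Fin.ext (by have := m.2; simp only; lia)
  simp only [hm'] at h
  refine h ?_
  rw [extremalColoring_comm, extremalColoring_eq_left (hm _) hm5,
    extremalColoring_eq_left (hm _) hm5]

theorem edgeColors_extremalColoring {n : ℕ} (hn : 5 ≤ n) :
    edgeColors (extremalColoring n) Finset.univ =
      {1, 2, 3, 4, 7, 8, 9, 13, 14, 19} ∪ Finset.Ico 25 (n + 20) := by
  ext q
  simp only [edgeColors, Finset.mem_image, Finset.mem_offDiag, Finset.mem_univ, true_and,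
    Finset.mem_union, Finset.mem_Ico, Prod.exists]
  constructor
  · rintro ⟨i, j, hij, rfl⟩
    have := Fin.val_ne_of_ne hij
    have := i.2
    have := j.2
    rw [extremalColoring]
    split_ifs with h
    · obtain ⟨hi, hj⟩ := max_lt_iff.1 h
      left
      generalize i.1 = a at *
      generalize j.1 = b at *
      interval_cases a <;> interval_cases b <;> simp_all
    · right
      lia
  · intro hq
    have key : ∀ a b, ∀ hab : a < b, ∀ hb : b < n, (if b < 5 then 5 * a + b else 20 + b) = q →
        ∃ i j, i ≠ j ∧ extremalColoring n i j = q := by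
      intro a b hab hb hq
      refine ⟨⟨a, hab.trans hb⟩, ⟨b, hb⟩, by simp [hab.ne], ?_⟩
      rw [extremalColoring, max_eq_right hab.le, min_eq_left hab.le, hq]
    rcases hq with hq | hq
    · simp only [Finset.mem_insert, Finset.mem_singleton] at hq
      rcases hq with h | h | h | h | h | h | h | h | h | h
      · exact key 0 1 (by lia) (by lia) (by simp [h])
      · exact key 0 2 (by lia) (by lia) (by simp [h])
      · exact key 0 3 (by lia) (by lia) (by simp [h])
      · exact key 0 4 (by lia) (by lia) (by simp [h])
      · exact key 1 2 (by lia) (by lia) (by simp [h])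
      · exact key 1 3 (by lia) (by lia) (by simp [h])
      · exact key 1 4 (by lia) (by lia) (by simp [h])
      · exact key 2 3 (by lia) (by lia) (by simp [h])
      · exact key 2 4 (by lia) (by lia) (by simp [h])
      · exact key 3 4 (by lia) (by lia) (by simp [h])
    · exact key 0 (q - 20) (by lia) (by lia) (by rw [if_neg (by lia)]; lia)

theorem colorsUsed_extremalColoring {n : ℕ} (hn : 5 ≤ n) :
    colorsUsed n (extremalColoring n) = n + 5 := by
  rw [colorsUsed_eq_card_edgeColors, edgeColors_extremalColoring hn, Finset.card_union_of_disjoint,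
    Nat.card_Ico]
  · have : ({1, 2, 3, 4, 7, 8, 9, 13, 14, 19} : Finset ℕ).card = 10 := rfl
    lia
  · rw [Finset.disjoint_left]
    intro q hq
    simp only [Finset.mem_insert, Finset.mem_singleton, Finset.mem_Ico] at hq ⊢
    lia

/-- For every `n ≥ 6`, the maximum number of colors in an edge-coloring of `K_n`
with no properly colored `C_6` equals `n + 5`. -/
theorem pr_C6 (n : ℕ) (hn : 6 ≤ n) :
    IsGreatest {m : ℕ | ∃ c : Fin n → Fin n → ℕ, (∀ i j, c i j = c j i) ∧
      ¬ HasPCCycle n 6 c ∧ colorsUsed n c = m} (n + 5) := by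
  refine ⟨⟨extremalColoring n, extremalColoring_comm n, not_hasPCCycle_extremalColoring n,
    colorsUsed_extremalColoring (by lia)⟩, ?_⟩
  rintro m ⟨c, symm, hc, rfl⟩
  rw [colorsUsed_eq_card_edgeColors]
  simpa using (avoidsSixCycle_of_not_hasPCCycle hc).card_edgeColors_le symm
    (S := Finset.univ) (by simp; lia)
end

section
/- For every n ≥ 5, every edge-coloring of K_n using at least 2n colors contains a properly colored copy of K_{2,3}; equivalently, pr(K_n, K_{2,3}) ≤ 2n - 1. -/
/-- The edge-colored `K_n` contains a properly colored copy of `K_{2,3}` with parts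
`{a, b}` and `{x, y, z}`: adjacent edges of the copy receive distinct colors. -/
def HasPCK23 (n : ℕ) (c : Fin n → Fin n → ℕ) : Prop :=
  ∃ a b x y z : Fin n, a ≠ b ∧ a ≠ x ∧ a ≠ y ∧ a ≠ z ∧ b ≠ x ∧ b ≠ y ∧ b ≠ z ∧
    x ≠ y ∧ x ≠ z ∧ y ≠ z ∧
    c a x ≠ c a y ∧ c a x ≠ c a z ∧ c a y ≠ c a z ∧
    c b x ≠ c b y ∧ c b x ≠ c b z ∧ c b y ≠ c b z ∧
    c a x ≠ c b x ∧ c a y ≠ c b y ∧ c a z ≠ c b z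

namespace ProperK23

variable {V : Type*}

/-- A properly colored copy of `K_{2,3}` in the edge-colored complete graph on `V`. -/
def HasProper (c : V → V → ℕ) : Prop :=
  ∃ a b x y z : V, a ≠ b ∧ a ≠ x ∧ a ≠ y ∧ a ≠ z ∧ b ≠ x ∧ b ≠ y ∧ b ≠ z ∧
    x ≠ y ∧ x ≠ z ∧ y ≠ z ∧
    c a x ≠ c a y ∧ c a x ≠ c a z ∧ c a y ≠ c a z ∧
    c b x ≠ c b y ∧ c b x ≠ c b z ∧ c b y ≠ c b z ∧
    c a x ≠ c b x ∧ c a y ≠ c b y ∧ c a z ≠ c b z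

/-- The color of the edge `vx` appears only on edges incident to `v`. -/
def Excl (c : V → V → ℕ) (v x : V) : Prop :=
  x ≠ v ∧ ∀ p q, p ≠ q → p ≠ v → q ≠ v → c p q ≠ c v x

/-- At least three distinct colors appear only on edges incident to `v`. -/
def ThreeExcl (c : V → V → ℕ) (v : V) : Prop :=
  ∃ x y z, Excl c v x ∧ Excl c v y ∧ Excl c v z ∧
    c v x ≠ c v y ∧ c v x ≠ c v z ∧ c v y ≠ c v z

/-- Two colors exclusive to `x` appear on edges from `x` to vertices other than `v` and `y`. -/
def TwoAvoiding (c : V → V → ℕ) (x v y : V) : Prop :=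
  ∃ b b', Excl c x b ∧ Excl c x b' ∧ c x b ≠ c x b' ∧ b ≠ v ∧ b ≠ y ∧ b' ≠ v ∧ b' ≠ y

variable {c : V → V → ℕ}

/-- If `vx`, `vy` carry distinct colors exclusive to `v` and `xp`, `yq` carry colors that
keep the stars at `x` and `y` properly colored, then `{x, y}`, `{v, p, q}` span a proper copy. -/
lemma hasProper_of_excl_center (hs : ∀ i j, c i j = c j i) {v x y p q : V}
    (hx : Excl c v x) (hy : Excl c v y) (hxy : c v x ≠ c v y)
    (hpv : p ≠ v) (hpx : p ≠ x) (hpy : p ≠ y) (hqv : q ≠ v) (hqx : q ≠ x) (hqy : q ≠ y)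
    (h₁ : c x p ≠ c x q) (h₂ : c y p ≠ c y q) (h₃ : c x p ≠ c y p) (h₄ : c x q ≠ c y q) :
    HasProper c := by
  obtain ⟨hxv, hx⟩ := hx
  obtain ⟨hyv, hy⟩ := hy
  have e1 := hs x v
  have e2 := hs y v
  refine ⟨x, y, v, p, q, by grind, hxv, hpx.symm, hqx.symm, hyv, hpy.symm, hqy.symm,
    hpv.symm, hqv.symm, by grind, ?_, ?_, h₁, ?_, ?_, h₂, by grind, h₃, h₄⟩
  · have := hx x p hpx.symm hxv hpv; grind
  · have := hx x q hqx.symm hxv hqv; grind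
  · have := hy y p hpy.symm hyv hpv; grind
  · have := hy y q hqy.symm hyv hqv; grind

lemma hasProper_of_twoAvoiding (hs : ∀ i j, c i j = c j i) {v x y : V}
    (hx : Excl c v x) (hy : Excl c v y) (hxy : c v x ≠ c v y)
    (hbx : TwoAvoiding c x v y) (hby : TwoAvoiding c y v x) : HasProper c := by
  by_contra hno
  have hne : x ≠ y := by grind
  have ex : ∀ {b}, Excl c x b → b ≠ y → c x b ≠ c y b := fun {b} hb hby =>
    (hb.2 y b hby.symm hne.symm hb.1).symm
  have ey : ∀ {b}, Excl c y b → b ≠ x → c x b ≠ c y b := fun {b} hb hbx =>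
    hb.2 x b hbx.symm hne hb.1
  obtain ⟨b, b', hb, hb', hbb, hbv, hby', hbv', hby''⟩ := hbx
  obtain ⟨e, e', he, he', hee, hev, hex', hev', hex''⟩ := hby
  have hβ : c y b = c y b' := by
    by_contra h
    exact hno (hasProper_of_excl_center hs hx hy hxy hbv hb.1 hby' hbv' hb'.1 hby''
      hbb h (ex hb hby') (ex hb' hby''))
  have hγ : c x e = c x e' := by
    by_contra h
    exact hno (hasProper_of_excl_center hs hx hy hxy hev hex' he.1 hev' hex'' he'.1
      h hee (ey he hex') (ey he' hex''))
  obtain ⟨p, hp, hpv, hpy, hpγ, hpβ⟩ : ∃ p, Excl c x p ∧ p ≠ v ∧ p ≠ y ∧ c x p ≠ c x e ∧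
      c y p = c y b := by
    by_cases h : c x b = c x e
    · exact ⟨b', hb', hbv', hby'', by grind, hβ.symm⟩
    · exact ⟨b, hb, hbv, hby', h, rfl⟩
  obtain ⟨q, hq, hqv, hqx, hqβ, hqγ⟩ : ∃ q, Excl c y q ∧ q ≠ v ∧ q ≠ x ∧ c y q ≠ c y b ∧
      c x q = c x e := by
    by_cases h : c y e = c y b
    · exact ⟨e', he', hev', hex'', by grind, hγ.symm⟩
    · exact ⟨e, he, hev, hex', h, rfl⟩
  exact hno (hasProper_of_excl_center hs hx hy hxy hpv hp.1 hpy hqv hqx hq.1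
    (by grind) (by grind) (ex hp hpy) (ey hq hqx))

lemma Excl.of_eq {x y b : V} (h : Excl c x y) (hb : b ≠ x) (he : c x b = c x y) :
    Excl c x b :=
  ⟨hb, fun p q h₁ h₂ h₃ => he ▸ h.2 p q h₁ h₂ h₃⟩

lemma excl_of_not_twoAvoiding (hs : ∀ i j, c i j = c j i) {v x y : V} (h3 : ThreeExcl c x)
    (hn : ¬ TwoAvoiding c x v y) : Excl c x v ∧ Excl c x y ∧ Excl c y x := by
  have key : ∀ b b', Excl c x b → Excl c x b' → b ≠ v → b ≠ y → b' ≠ v → b' ≠ y →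
      c x b = c x b' := by
    intro b b' h h' h1 h2 h3 h4
    by_contra hc
    exact hn ⟨b, b', h, h', hc, h1, h2, h3, h4⟩
  obtain ⟨hv, hy, w, hw, hwv, hwy, hvy⟩ : Excl c x v ∧ Excl c x y ∧ ∃ w, Excl c x w ∧
      c x w ≠ c x v ∧ c x w ≠ c x y ∧ c x v ≠ c x y := by
    obtain ⟨a, b, d, ha, hb, hd, hab, had, hbd⟩ := h3
    have := key a b ha hb
    have := key a d ha hd
    have := key b d hb hd
    by_cases a = v <;> by_cases a = y <;> by_cases b = v <;> by_cases b = y <;>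
      by_cases d = v <;> by_cases d = y <;> grind
  refine ⟨hv, hy, hy.1.symm, fun p q hpq hp hq he => ?_⟩
  have hyx := hs y x
  by_cases hpx : p = x
  · subst hpx
    have := key q w (hy.of_eq hpq.symm (he.trans hyx)) hw
    by_cases q = v <;> by_cases w = v <;> by_cases w = y <;> grind
  by_cases hqx : q = x
  · subst hqx
    have hqp := hs p q
    have := key p w (hy.of_eq hpq (by grind)) hw
    by_cases p = v <;> by_cases w = v <;> by_cases w = y <;> grind
  exact hy.2 p q hpq hpx hqx (he.trans hyx)

lemma excl_pair (hs : ∀ i j, c i j = c j i) (hno : ¬ HasProper c) (h3 : ∀ v, ThreeExcl c v)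
    {v x y : V} (hx : Excl c v x) (hy : Excl c v y) (hxy : c v x ≠ c v y) :
    Excl c x y ∧ Excl c y x ∧ (Excl c x v ∨ Excl c y v) := by
  by_cases h : TwoAvoiding c x v y
  · have h' : ¬ TwoAvoiding c y v x := fun h' =>
      hno (hasProper_of_twoAvoiding hs hx hy hxy h h')
    obtain ⟨h1, h2, h4⟩ := excl_of_not_twoAvoiding hs (h3 y) h'
    exact ⟨h4, h2, .inr h1⟩
  · obtain ⟨h1, h2, h4⟩ := excl_of_not_twoAvoiding hs (h3 x) h
    exact ⟨h2, h4, .inl h1⟩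

/-- Every edge among `v, x, y, z` has a color appearing on no other edge. -/
def RainbowBlock (c : V → V → ℕ) (v x y z : V) : Prop :=
  ∀ p q, p ≠ q → (p = v ∨ p = x ∨ p = y ∨ p = z) → (q = v ∨ q = x ∨ q = y ∨ q = z) →
    Excl c p q

lemma rainbowBlock_of_excl (hs : ∀ i j, c i j = c j i) (hno : ¬ HasProper c)
    (h3 : ∀ v, ThreeExcl c v) {v x y z : V} (hx : Excl c v x) (hy : Excl c v y)
    (hz : Excl c v z) (hxy : c v x ≠ c v y) (hxz : c v x ≠ c v z) (hyz : c v y ≠ c v z)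
    (hxv : Excl c x v) : RainbowBlock c v x y z := by
  obtain ⟨a1, a2, -⟩ := excl_pair hs hno h3 hx hy hxy
  obtain ⟨a3, a4, -⟩ := excl_pair hs hno h3 hx hz hxz
  obtain ⟨a5, a6, -⟩ := excl_pair hs hno h3 hy hz hyz
  have e := hs x v
  have n1 : c x v ≠ c x y := by have := hx.2 x y a1.1.symm hx.1 hy.1; grind
  have n2 : c x v ≠ c x z := by have := hx.2 x z a3.1.symm hx.1 hz.1; grind
  obtain ⟨a7, a8, -⟩ := excl_pair hs hno h3 hxv a1 n1
  obtain ⟨a9, a10, -⟩ := excl_pair hs hno h3 hxv a3 n2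
  rintro p q hpq (rfl | rfl | rfl | rfl) (rfl | rfl | rfl | rfl) <;>
    first | assumption | exact absurd rfl hpq

lemma exists_rainbowBlock (hs : ∀ i j, c i j = c j i) (hno : ¬ HasProper c)
    (h3 : ∀ v, ThreeExcl c v) (v : V) :
    ∃ x y z, x ≠ v ∧ y ≠ v ∧ z ≠ v ∧ x ≠ y ∧ x ≠ z ∧ y ≠ z ∧ RainbowBlock c v x y z := by
  obtain ⟨x, y, z, hx, hy, hz, hxy, hxz, hyz⟩ := h3 v
  obtain ⟨-, -, h | h⟩ := excl_pair hs hno h3 hx hy hxy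
  · exact ⟨x, y, z, hx.1, hy.1, hz.1, by grind, by grind, by grind,
      rainbowBlock_of_excl hs hno h3 hx hy hz hxy hxz hyz h⟩
  · exact ⟨y, x, z, hy.1, hx.1, hz.1, by grind, by grind, by grind,
      rainbowBlock_of_excl hs hno h3 hy hx hz hxy.symm hyz hxz h⟩

lemma RainbowBlock.color_eq (hs : ∀ i j, c i j = c j i) (hno : ¬ HasProper c)
    (h3 : ∀ v, ThreeExcl c v) {p q r s b : V} (hB : RainbowBlock c p q r s)
    (hpq : p ≠ q) (hpr : p ≠ r) (hps : p ≠ s) (hqr : q ≠ r) (hqs : q ≠ s) (hrs : r ≠ s)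
    (hbp : b ≠ p) (hbq : b ≠ q) (hbr : b ≠ r) (hbs : b ≠ s) : c b p = c b q := by
  by_contra hne
  obtain ⟨y, hy, hyp, hyq⟩ : ∃ y, Excl c b y ∧ c b y ≠ c b p ∧ c b y ≠ c b q := by
    obtain ⟨y₁, y₂, y₃, h₁, h₂, h₃, n₁, n₂, n₃⟩ := h3 b
    by_contra! h
    have := h y₁ h₁
    have := h y₂ h₂
    have := h y₃ h₃
    grind
  have hyp' : y ≠ p := by grind
  have hyq' : y ≠ q := by grind
  obtain ⟨a, hay, hap, haq, hab, hpa, hqa, hap', haq'⟩ : ∃ a, a ≠ y ∧ a ≠ p ∧ a ≠ q ∧ a ≠ b ∧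
      Excl c p a ∧ Excl c q a ∧ Excl c a p ∧ Excl c a q := by
    by_cases h : r = y
    · exact ⟨s, by grind, hps.symm, hqs.symm, hbs.symm, hB _ _ hps (by simp) (by simp),
        hB _ _ hqs (by simp) (by simp), hB _ _ hps.symm (by simp) (by simp),
        hB _ _ hqs.symm (by simp) (by simp)⟩
    · exact ⟨r, h, hpr.symm, hqr.symm, hbr.symm, hB _ _ hpr (by simp) (by simp),
        hB _ _ hqr (by simp) (by simp), hB _ _ hpr.symm (by simp) (by simp),
        hB _ _ hqr.symm (by simp) (by simp)⟩
  have e1 := hs a p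
  have e2 := hs a q
  refine hno ⟨a, b, p, q, y, hab, hap, haq, hay, hbp, hbq, hy.1.symm, hpq, hyp'.symm,
    hyq'.symm, ?_, ?_, ?_, hne, hyp.symm, hyq.symm, ?_, ?_, ?_⟩
  · have := hpa.2 a q haq hap hpq.symm; grind
  · have := hpa.2 a y hay hap hyp'; grind
  · have := hqa.2 a y hay haq hyq'; grind
  · exact (hap'.2 b p hbp hab.symm hap.symm).symm
  · exact (haq'.2 b q hbq hab.symm haq.symm).symm
  · exact hy.2 a y hay hab hy.1

lemma exists_contractible (hs : ∀ i j, c i j = c j i) (hno : ¬ HasProper c)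
    (h3 : ∀ v, ThreeExcl c v) (v : V) :
    ∃ x y z, x ≠ v ∧ y ≠ v ∧ z ≠ v ∧ x ≠ y ∧ x ≠ z ∧ y ≠ z ∧
      ∀ b, b ≠ v → b ≠ x → b ≠ y → b ≠ z → c b x = c b v ∧ c b y = c b v ∧ c b z = c b v := by
  obtain ⟨x, y, z, hxv, hyv, hzv, hxy, hxz, hyz, hB⟩ := exists_rainbowBlock hs hno h3 v
  refine ⟨x, y, z, hxv, hyv, hzv, hxy, hxz, hyz, fun b hbv hbx hby hbz => ?_⟩
  have hBx : RainbowBlock c x v y z := fun p q h hp hq => hB p q h (by tauto) (by tauto)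
  have hBy : RainbowBlock c y v x z := fun p q h hp hq => hB p q h (by tauto) (by tauto)
  have hBz : RainbowBlock c z v x y := fun p q h hp hq => hB p q h (by tauto) (by tauto)
  exact ⟨hBx.color_eq hs hno h3 hxv hxy hxz hyv.symm hzv.symm hyz hbx hbv hby hbz,
    hBy.color_eq hs hno h3 hyv hxy.symm hyz hxv.symm hzv.symm hxz hby hbv hbx hbz,
    hBz.color_eq hs hno h3 hzv hxz.symm hyz.symm hxv.symm hyv.symm hxy hbz hbv hbx hby⟩

/-- The colors appearing on edges inside `S`. -/
def colors [DecidableEq V] (c : V → V → ℕ) (S : Finset V) : Finset ℕ :=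
  S.offDiag.image fun p => c p.1 p.2

lemma mem_colors [DecidableEq V] {S : Finset V} {k : ℕ} :
    k ∈ colors c S ↔ ∃ p ∈ S, ∃ q ∈ S, p ≠ q ∧ c p q = k := by
  simp only [colors, Finset.mem_image, Finset.mem_offDiag, Prod.exists]
  grind

/-- A block whose outside vertices each see it in one color can be contracted at the cost of
at most six colors. -/
lemma card_colors_le_of_block [DecidableEq V] (hs : ∀ i j, c i j = c j i) {S : Finset V}
    {v x y z : V} (hv : v ∈ S) (hxv : x ≠ v) (hyv : y ≠ v) (hzv : z ≠ v)
    (h : ∀ b ∈ S, b ≠ v → b ≠ x → b ≠ y → b ≠ z →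
      c b x = c b v ∧ c b y = c b v ∧ c b z = c b v) :
    (colors c S).card ≤ (colors c (S \ {x, y, z})).card + 6 := by
  have hsub : colors c S ⊆ colors c (S \ {x, y, z}) ∪
      {c v x, c v y, c v z, c x y, c x z, c y z} := by
    intro k hk
    obtain ⟨p, hp, q, hq, hpq, rfl⟩ := mem_colors.1 hk
    rw [Finset.mem_union, or_iff_not_imp_right]
    intro hk'
    simp only [Finset.mem_insert, Finset.mem_singleton, not_or] at hk'
    have rep : ∀ a b, a ∈ S → b ∈ S → a ≠ b → a ≠ x → a ≠ y → a ≠ z →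
        (a = v → b ≠ x ∧ b ≠ y ∧ b ≠ z) → c a b ∈ colors c (S \ {x, y, z}) := by
      intro a b ha hb hab hax hay haz hav
      by_cases hb' : b = x ∨ b = y ∨ b = z
      · have hav' : a ≠ v := by grind
        refine mem_colors.2 ⟨a, by simp_all, v, by simp_all [eq_comm], hav', ?_⟩
        have := h a ha hav' hax hay haz
        grind
      · exact mem_colors.2 ⟨a, by simp_all, b, by simp_all, hab, rfl⟩
    have e := hs p q
    by_cases hp' : p = x ∨ p = y ∨ p = z
    · rw [e]
      refine rep q p hq hp hpq.symm ?_ ?_ ?_ ?_ <;> grind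
    · refine rep p q hp hq hpq ?_ ?_ ?_ ?_ <;> grind
  calc (colors c S).card ≤ _ := Finset.card_le_card hsub
    _ ≤ _ := Finset.card_union_le _ _
    _ ≤ _ := Nat.add_le_add_left Finset.card_le_six _

/-- A vertex whose deletion destroys three colors has three exclusive colors. -/
lemma threeExcl_of_card [DecidableEq V] (hs : ∀ i j, c i j = c j i) {S : Finset V} (v : S)
    (h : (colors c (S.erase v)).card + 3 ≤ (colors c S).card) :
    ThreeExcl (fun i j : S => c i j) v := by
  have hc : 2 < (colors c S \ colors c (S.erase v)).card := by
    have := Finset.le_card_sdiff (colors c (S.erase v)) (colors c S)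
    omega
  obtain ⟨i, j, k, hi, hj, hk, hij, hik, hjk⟩ := Finset.two_lt_card_iff.1 hc
  have key : ∀ m ∈ colors c S \ colors c (S.erase v),
      ∃ x : S, Excl (fun i j : S => c i j) v x ∧ c v x = m := by
    intro m hm
    rw [Finset.mem_sdiff, mem_colors, mem_colors] at hm
    obtain ⟨⟨p, hp, q, hq, hpq, rfl⟩, hm⟩ := hm
    push Not at hm
    have hex : ∀ w : S, w ≠ v → c v w = c p q →
        Excl (fun i j : S => c i j) v w := by
      refine fun w hw he => ⟨hw, fun a b hab ha hb => ?_⟩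
      have := hm a (by simp [Subtype.coe_injective.ne ha]) b
        (by simp [Subtype.coe_injective.ne hb]) (Subtype.coe_injective.ne hab)
      grind
    by_cases hpv : p = v
    · exact ⟨⟨q, hq⟩, hex _ (by grind) (by rw [hpv]), by rw [hpv]⟩
    by_cases hqv : q = v
    · exact ⟨⟨p, hp⟩, hex _ (by grind) (by rw [hqv, hs]), by rw [hqv, hs]⟩
    · exact absurd rfl (hm p (by simp [hp, hpv]) q (by simp [hq, hqv]) hpq)
  obtain ⟨x, hx, rfl⟩ := key i hi
  obtain ⟨y, hy, rfl⟩ := key j hj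
  obtain ⟨z, hz, rfl⟩ := key k hk
  exact ⟨x, y, z, hx, hy, hz, hij, hik, hjk⟩

lemma HasProper.of_subtype {S : Finset V} (h : HasProper fun i j : S => c i j) :
    HasProper c := by
  obtain ⟨a, b, x, y, z, h⟩ := h
  refine ⟨a, b, x, y, z, ?_⟩
  simpa only [ne_eq, Subtype.ext_iff] using h

lemma card_colors_lt [DecidableEq V] (hs : ∀ i j, c i j = c j i) (hno : ¬ HasProper c)
    (S : Finset V) (hS : S.Nonempty) : (colors c S).card < 2 * S.card := by
  induction S using Finset.strongInduction with
  | H S ih =>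
  by_contra! hlt
  obtain ⟨v, hv⟩ := hS
  have h3 : ∀ w : S, ThreeExcl (fun i j : S => c i j) w := by
    intro w
    apply threeExcl_of_card hs
    have hcard := Finset.card_erase_add_one w.2
    rcases (S.erase w).eq_empty_or_nonempty with he | he
    · have hw : S = {w.1} := by
        have := Finset.insert_erase w.2
        rw [he] at this
        exact this.symm
      rw [hw] at hlt
      simp [colors] at hlt
    · have := ih _ (Finset.erase_ssubset w.2) he
      omega
  have hs' : ∀ i j : S, c i j = c j i := fun i j => hs i j
  have hno' : ¬ HasProper fun i j : S => c i j := fun h => hno h.of_subtype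
  obtain ⟨x, y, z, hxv, hyv, hzv, hxy, hxz, hyz, hB⟩ :=
    exists_contractible hs' hno' h3 ⟨v, hv⟩
  have hle := card_colors_le_of_block (c := c) (S := S) (x := x) (y := y) (z := z) hs hv
    (Subtype.coe_injective.ne hxv) (Subtype.coe_injective.ne hyv)
    (Subtype.coe_injective.ne hzv) fun b hb hbv hbx hby hbz => hB ⟨b, hb⟩
      (fun h => hbv (congrArg Subtype.val h)) (fun h => hbx (congrArg Subtype.val h))
      (fun h => hby (congrArg Subtype.val h)) (fun h => hbz (congrArg Subtype.val h))
  have hsub : ({x.1, y.1, z.1} : Finset V) ⊆ S := by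
    simp [Finset.insert_subset_iff]
  have h3card : ({x.1, y.1, z.1} : Finset V).card = 3 :=
    Finset.card_eq_three.2 ⟨x, y, z, Subtype.coe_injective.ne hxy,
      Subtype.coe_injective.ne hxz, Subtype.coe_injective.ne hyz, rfl⟩
  have hsd := Finset.card_sdiff_add_card_eq_card hsub
  have := ih (S \ {x.1, y.1, z.1}) (Finset.sdiff_ssubset hsub (by simp)) ⟨v, by
    have := Subtype.coe_injective.ne hxv
    have := Subtype.coe_injective.ne hyv
    have := Subtype.coe_injective.ne hzv
    simp_all [eq_comm]⟩
  omega

end ProperK23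

/-- For every `n ≥ 5`, every edge-coloring of `K_n` using at least `2n` colors
contains a properly colored copy of `K_{2,3}`. -/
theorem pr_K23_upper (n : ℕ) (hn : 5 ≤ n) (c : Fin n → Fin n → ℕ)
    (hsym : ∀ i j, c i j = c j i) (hcol : 2 * n ≤ colorsUsed n c) :
    HasPCK23 n c := by
  by_contra hno
  have h := ProperK23.card_colors_lt hsym hno Finset.univ ⟨⟨0, by omega⟩, Finset.mem_univ _⟩
  have he : ProperK23.colors c Finset.univ =
      (Finset.univ.filter fun p : Fin n × Fin n => p.1 ≠ p.2).image fun p => c p.1 p.2 := by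
    unfold ProperK23.colors
    congr 1
    ext p
    simp
  rw [he, Finset.card_fin] at h
  exact absurd hcol (not_le.2 h)
end
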